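/- Let V : ℝ → ℝ be real analytic on all of ℝ with lim_{x→±∞} V(x)/(|x|+1) = +∞, and suppose (a, b, ψ, ℓ) are one-cut regular equilibrium data for V. For each n ≥ 1, let p_n be a monic polynomial of degree n with real coefficients satisfying ∫_ℝ p_n(x) e^{kx} e^{−nV(x)} dx = 0 for k = 0, 1, …, n−1, and suppose p_n(z) = ∏_{j=1}^n (z − z_j^{(n)}) with all z_j^{(n)} ∈ ℝ; likewise let q_n be a monic polynomial of degree n with real coefficients satisfying ∫_ℝ x^k q_n(e^x) e^{−nV(x)} dx = 0 for k = 0, 1, …, n−1, and suppose q_n(w) = ∏_{j=1}^n (w − e^{ẑ_j^{(n)}}) with all ẑ_j^{(n)} ∈ ℝ. Then the normalized zero counting measures μ_n := (1/n)∑_{j=1}^n δ_{z_j^{(n)}} and μ̂_n := (1/n)∑_{j=1}^n δ_{ẑ_j^{(n)}} both converge weakly, as n → ∞, to the measure ψ(x)dx on [a,b]; that is, for every bounded continuous f : ℝ → ℝ, (1/n)∑_{j=1}^n f(z_j^{(n)}) → ∫_a^b f(x)ψ(x)dx and (1/n)∑_{j=1}^n f(ẑ_j^{(n)}) → ∫_a^b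 f(x)ψ(x)dx. -/

import Mathlib

open MeasureTheory Filter Set

/-- One-cut regular equilibrium data `(a, b, ψ, ℓ)` for the external field `V`:
conditions (i)–(v) of the paper, with the logarithmic integrals required to converge. -/
structure OneCutData (V : ℝ → ℝ) (a b : ℝ) (ψ : ℝ → ℝ) (ℓ : ℝ) : Prop where
  lt : a < b
  cont : ContinuousOn ψ (Icc a b)
  nonneg : ∀ x ∈ Icc a b, 0 ≤ ψ x
  total_mass : ∫ x in a..b, ψ x = 1
  pos : ∀ x ∈ Ioo a b, 0 < ψ x
  sqrt_left : ∃ L : ℝ, L ≠ 0 ∧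
    Tendsto (fun x => ψ x / Real.sqrt (x - a)) (nhdsWithin a (Ioi a)) (nhds L)
  sqrt_right : ∃ L : ℝ, L ≠ 0 ∧
    Tendsto (fun x => ψ x / Real.sqrt (b - x)) (nhdsWithin b (Iio b)) (nhds L)
  integrable_log : ∀ x ∈ Icc a b,
    IntervalIntegrable (fun t => -Real.log |t - x| * ψ t) volume a b
  integrable_explog : ∀ x ∈ Icc a b,
    IntervalIntegrable (fun t => -Real.log |Real.exp t - Real.exp x| * ψ t) volume a b
  var_eq : ∀ x ∈ Icc a b,
    (∫ t in a..b, -Real.log |t - x| * ψ t)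
      + (∫ t in a..b, -Real.log |Real.exp t - Real.exp x| * ψ t) + V x + ℓ = 0
  var_ineq : ∀ x : ℝ, x ∉ Icc a b →
    0 < (∫ t in a..b, -Real.log |t - x| * ψ t)
      + (∫ t in a..b, -Real.log |Real.exp t - Real.exp x| * ψ t) + V x + ℓ

/-- The pairing of the kernel `f (x - y)` with `(μ - ν) ⊗ (μ - ν)`. -/
noncomputable def diffEnergy (μ ν : Measure ℝ) (f : ℝ → ℝ) : ℝ :=
  ∫ p, f (p.1 - p.2) ∂(μ.prod μ) - 2 * ∫ p, f (p.1 - p.2) ∂(μ.prod ν)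
    + ∫ p, f (p.1 - p.2) ∂(ν.prod ν)

lemma re_charFun (μ : Measure ℝ) [IsProbabilityMeasure μ] (u : ℝ) :
    (charFun μ u).re = ∫ x, Real.cos (u * x) ∂μ := by
  rw [charFun_apply_real]
  have : Integrable (fun x : ℝ => Complex.exp (u * x * Complex.I)) μ := by
    refine Integrable.of_bound (by fun_prop) 1 (ae_of_all _ fun x => ?_)
    rw [show (u : ℂ) * x * Complex.I = ((u * x : ℝ) : ℂ) * Complex.I by push_cast; ring,
      Complex.norm_exp_ofReal_mul_I]
  have h := integral_re this
  simp only [RCLike.re_to_complex] at h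
  rw [← h]
  refine integral_congr_ae (ae_of_all _ fun x => ?_)
  simp only
  rw [show (u : ℂ) * x * Complex.I = ((u * x : ℝ) : ℂ) * Complex.I by push_cast; ring,
    Complex.exp_ofReal_mul_I_re]

lemma im_charFun (μ : Measure ℝ) [IsProbabilityMeasure μ] (u : ℝ) :
    (charFun μ u).im = ∫ x, Real.sin (u * x) ∂μ := by
  rw [charFun_apply_real]
  have : Integrable (fun x : ℝ => Complex.exp (u * x * Complex.I)) μ := by
    refine Integrable.of_bound (by fun_prop) 1 (ae_of_all _ fun x => ?_)
    rw [show (u : ℂ) * x * Complex.I = ((u * x : ℝ) : ℂ) * Complex.I by push_cast; ring,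
      Complex.norm_exp_ofReal_mul_I]
  have h := integral_im this
  simp only [RCLike.im_to_complex] at h
  rw [← h]
  refine integral_congr_ae (ae_of_all _ fun x => ?_)
  simp only
  rw [show (u : ℂ) * x * Complex.I = ((u * x : ℝ) : ℂ) * Complex.I by push_cast; ring,
    Complex.exp_ofReal_mul_I_im]

lemma integral_prod_cos_sub (μ ν : Measure ℝ) [IsProbabilityMeasure μ] [IsProbabilityMeasure ν]
    (u : ℝ) :
    ∫ p, Real.cos (u * (p.1 - p.2)) ∂(μ.prod ν)
      = (charFun μ u).re * (charFun ν u).re + (charFun μ u).im * (charFun ν u).im := by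
  rw [re_charFun, re_charFun, im_charFun, im_charFun, ← integral_prod_mul, ← integral_prod_mul,
    ← integral_add]
  · refine integral_congr_ae (ae_of_all _ fun p => ?_)
    simp only
    rw [mul_sub, Real.cos_sub]
  · refine Integrable.of_bound (by fun_prop) 1 (ae_of_all _ fun p => ?_)
    rw [norm_mul]
    exact mul_le_one₀ (Real.abs_cos_le_one _) (norm_nonneg _) (Real.abs_cos_le_one _)
  · refine Integrable.of_bound (by fun_prop) 1 (ae_of_all _ fun p => ?_)
    rw [norm_mul]
    exact mul_le_one₀ (Real.abs_sin_le_one _) (norm_nonneg _) (Real.abs_sin_le_one _)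

lemma diffEnergy_cos (μ ν : Measure ℝ) [IsProbabilityMeasure μ] [IsProbabilityMeasure ν] (u : ℝ) :
    diffEnergy μ ν (fun r => Real.cos (u * r)) = ‖charFun μ u - charFun ν u‖ ^ 2 := by
  rw [diffEnergy, integral_prod_cos_sub, integral_prod_cos_sub, integral_prod_cos_sub,
    ← Complex.normSq_eq_norm_sq, Complex.normSq_apply, Complex.sub_re, Complex.sub_im]
  ring

lemma integral_exp_neg_mul_cos {s : ℝ} (hs : 0 < s) (r : ℝ) :
    ∫ u in Ioi (0 : ℝ), Real.exp (-s * u) * Real.cos (u * r) = s / (r ^ 2 + s ^ 2) := by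
  have hre : (-(s : ℂ) + r * Complex.I).re < 0 := by simpa using hs
  have h := integral_exp_mul_complex_Ioi hre 0
  have hi := integral_re (integrableOn_exp_mul_complex_Ioi hre 0)
  rw [h] at hi
  have e1 : ∀ u : ℝ, RCLike.re (Complex.exp ((-(s : ℂ) + r * Complex.I) * u))
      = Real.exp (-s * u) * Real.cos (u * r) := by
    intro u
    rw [RCLike.re_to_complex, Complex.exp_re]
    simp [mul_comm]
  simp only [e1] at hi
  rw [hi]
  have hne : r ^ 2 + s ^ 2 ≠ 0 := by positivity
  simp [Complex.div_re, Complex.normSq_apply]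
  field_simp
  ring

lemma integral_poisson_eq (m : Measure (ℝ × ℝ)) [IsFiniteMeasure m] {s : ℝ} (hs : 0 < s) :
    ∫ p, s / ((p.1 - p.2) ^ 2 + s ^ 2) ∂m
      = ∫ u in Ioi (0 : ℝ), Real.exp (-s * u) * ∫ p, Real.cos (u * (p.1 - p.2)) ∂m := by
  simp_rw [← integral_exp_neg_mul_cos hs, ← integral_const_mul]
  refine integral_integral_swap ?_
  have hexp : Integrable (fun u : ℝ => Real.exp (-s * u)) (volume.restrict (Ioi 0)) :=
    integrableOn_exp_mul_Ioi (by linarith) 0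
  have h2 : Integrable (fun q : (ℝ × ℝ) × ℝ => (1 : ℝ) * Real.exp (-s * q.2))
      (m.prod (volume.restrict (Ioi 0))) := (integrable_const (1 : ℝ)).mul_prod hexp
  refine h2.mono' (by fun_prop) (ae_of_all _ fun q => ?_)
  simp only [Function.uncurry, norm_mul, Real.norm_eq_abs, Real.abs_exp, one_mul]
  exact mul_le_of_le_one_right (Real.exp_pos _).le (Real.abs_cos_le_one _)

lemma integrable_exp_mul_integral_cos (m : Measure (ℝ × ℝ)) [IsFiniteMeasure m] {s : ℝ}
    (hs : 0 < s) :
    IntegrableOn (fun u => Real.exp (-s * u) * ∫ p, Real.cos (u * (p.1 - p.2)) ∂m) (Ioi 0) := by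
  have hexp : Integrable (fun u : ℝ => Real.exp (-s * u)) (volume.restrict (Ioi 0)) :=
    integrableOn_exp_mul_Ioi (by linarith) 0
  have h2 : Integrable (fun q : ℝ × (ℝ × ℝ) => Real.exp (-s * q.1) * (1 : ℝ))
      ((volume.restrict (Ioi 0)).prod m) := hexp.mul_prod (integrable_const (1 : ℝ))
  have h3 : Integrable (fun q : ℝ × (ℝ × ℝ) => Real.exp (-s * q.1) *
      Real.cos (q.1 * (q.2.1 - q.2.2))) ((volume.restrict (Ioi 0)).prod m) := by
    refine h2.mono' (by fun_prop) (ae_of_all _ fun q => ?_)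
    simp only [norm_mul, Real.norm_eq_abs, Real.abs_exp, mul_one]
    exact mul_le_of_le_one_right (Real.exp_pos _).le (Real.abs_cos_le_one _)
  have h4 := h3.integral_prod_left
  simp only [integral_const_mul] at h4
  exact h4

lemma diffEnergy_poisson (μ ν : Measure ℝ) [IsProbabilityMeasure μ] [IsProbabilityMeasure ν]
    {s : ℝ} (hs : 0 < s) :
    diffEnergy μ ν (fun r => s / (r ^ 2 + s ^ 2))
      = ∫ u in Ioi (0 : ℝ), Real.exp (-s * u) * ‖charFun μ u - charFun ν u‖ ^ 2 := by
  simp_rw [← diffEnergy_cos]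
  simp only [diffEnergy]
  rw [integral_poisson_eq _ hs, integral_poisson_eq _ hs, integral_poisson_eq _ hs,
    ← integral_const_mul, ← integral_sub, ← integral_add]
  · refine integral_congr_ae (ae_of_all _ fun u => ?_)
    ring
  · exact (integrable_exp_mul_integral_cos _ hs).sub
      ((integrable_exp_mul_integral_cos _ hs).const_mul 2)
  · exact integrable_exp_mul_integral_cos _ hs
  · exact integrable_exp_mul_integral_cos _ hs
  · exact (integrable_exp_mul_integral_cos _ hs).const_mul 2

/-- The regularized logarithm `log √(r² + s²)`. -/
noncomputable def regLog (s r : ℝ) : ℝ := 1 / 2 * Real.log (r ^ 2 + s ^ 2)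

lemma regLog_sub_eq_integral {s S : ℝ} (hs : 0 < s) (hS : s ≤ S) (r : ℝ) :
    regLog S r - regLog s r = ∫ t in s..S, t / (r ^ 2 + t ^ 2) := by
  symm
  have hpos : ∀ t ∈ uIcc s S, 0 < r ^ 2 + t ^ 2 := by
    intro t ht
    rw [uIcc_of_le hS] at ht
    have : 0 < t := hs.trans_le ht.1
    positivity
  refine intervalIntegral.integral_eq_sub_of_hasDerivAt (f := fun t => regLog t r) ?_ ?_
  · intro t ht
    have h1 : HasDerivAt (fun t : ℝ => r ^ 2 + t ^ 2) (2 * t) t := by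
      simpa using (hasDerivAt_pow 2 t).const_add (r ^ 2)
    have h2 := (h1.log (hpos t ht).ne').const_mul (1 / 2)
    rw [show t / (r ^ 2 + t ^ 2) = 1 / 2 * (2 * t / (r ^ 2 + t ^ 2)) by ring]
    exact h2
  · refine ContinuousOn.intervalIntegrable ?_
    exact continuousOn_id.div (by fun_prop) fun t ht => (hpos t ht).ne'

lemma continuous_regLog {s : ℝ} (hs : 0 < s) : Continuous (regLog s) := by
  unfold regLog
  refine continuous_const.mul (Continuous.log (by fun_prop) fun r => ?_)
  positivity

lemma abs_regLog_sub_log_le {s : ℝ} (hs : 0 < s) (r : ℝ) :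
    |regLog s r - Real.log s| ≤ r ^ 2 / (2 * s ^ 2) := by
  have h : regLog s r - Real.log s = 1 / 2 * Real.log (1 + r ^ 2 / s ^ 2) := by
    have : r ^ 2 + s ^ 2 = s ^ 2 * (1 + r ^ 2 / s ^ 2) := by field_simp; ring
    rw [regLog, this, Real.log_mul (by positivity) (by positivity), Real.log_pow]
    push_cast
    ring
  have h0 : 0 ≤ r ^ 2 / s ^ 2 := by positivity
  rw [h, abs_of_nonneg (mul_nonneg (by norm_num) (Real.log_nonneg (by linarith)))]
  have := Real.log_le_sub_one_of_pos (show 0 < 1 + r ^ 2 / s ^ 2 by positivity)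
  calc 1 / 2 * Real.log (1 + r ^ 2 / s ^ 2) ≤ 1 / 2 * (r ^ 2 / s ^ 2) := by linarith
    _ = _ := by field_simp

lemma ae_prod_sub_le {μ ν : Measure ℝ} [IsProbabilityMeasure μ] [IsProbabilityMeasure ν] {R : ℝ}
    (hμ : ∀ᵐ x ∂μ, |x| ≤ R) (hν : ∀ᵐ x ∂ν, |x| ≤ R) :
    ∀ᵐ p ∂(μ.prod ν), |p.1 - p.2| ≤ 2 * R := by
  have h1 := Measure.quasiMeasurePreserving_fst (μ := μ) (ν := ν) |>.ae hμ
  have h2 := Measure.quasiMeasurePreserving_snd (μ := μ) (ν := ν) |>.ae hν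
  filter_upwards [h1, h2] with p hp1 hp2
  have := abs_sub p.1 p.2
  linarith

lemma integrable_of_ae_sub_le {m : Measure (ℝ × ℝ)} [IsFiniteMeasure m] {R : ℝ}
    (hm : ∀ᵐ p ∂m, |p.1 - p.2| ≤ R) {f : ℝ → ℝ} (hf : Continuous f) :
    Integrable (fun p : ℝ × ℝ => f (p.1 - p.2)) m := by
  obtain ⟨C, hC⟩ := (isCompact_Icc (a := -R) (b := R)).exists_bound_of_continuousOn hf.continuousOn
  refine Integrable.of_bound (by fun_prop) C ?_
  filter_upwards [hm] with p hp
  exact hC _ (abs_le.1 hp)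

lemma integral_regLog_sub {m : Measure (ℝ × ℝ)} [IsFiniteMeasure m] {R : ℝ}
    (hm : ∀ᵐ p ∂m, |p.1 - p.2| ≤ R) {s S : ℝ} (hs : 0 < s) (hS : s ≤ S) :
    ∫ p, regLog S (p.1 - p.2) ∂m - ∫ p, regLog s (p.1 - p.2) ∂m
      = ∫ t in s..S, ∫ p, t / ((p.1 - p.2) ^ 2 + t ^ 2) ∂m ∧
    IntervalIntegrable (fun t => ∫ p, t / ((p.1 - p.2) ^ 2 + t ^ 2) ∂m) volume s S := by
  have : IsFiniteMeasure (volume.restrict (uIoc s S)) :=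
    isFiniteMeasure_restrict.2 measure_Ioc_lt_top.ne
  have hint : Integrable (Function.uncurry fun (t : ℝ) (p : ℝ × ℝ) =>
      t / ((p.1 - p.2) ^ 2 + t ^ 2)) ((volume.restrict (uIoc s S)).prod m) := by
    refine Integrable.of_bound (C := 1 / s) ?_ ?_
    · refine Measurable.aestronglyMeasurable ?_
      simp only [Function.uncurry_def]
      fun_prop
    · have h1 : ∀ᵐ t ∂(volume.restrict (uIoc s S)), t ∈ uIoc s S :=
        ae_restrict_mem measurableSet_uIoc
      have h2 := Measure.quasiMeasurePreserving_fst (μ := volume.restrict (uIoc s S)) (ν := m)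
        |>.ae h1
      filter_upwards [h2] with q hq
      rw [uIoc_of_le hS] at hq
      have ht : 0 < q.1 := hs.trans hq.1
      simp only [Function.uncurry]
      rw [Real.norm_of_nonneg (by positivity), div_le_div_iff₀ (by positivity) hs]
      nlinarith [sq_nonneg (q.2.1 - q.2.2), hq.1]
  constructor
  · rw [intervalIntegral_integral_swap hint, ← integral_sub]
    · refine integral_congr_ae (ae_of_all _ fun p => ?_)
      exact regLog_sub_eq_integral hs hS _
    · exact integrable_of_ae_sub_le hm (continuous_regLog (hs.trans_le hS))
    · exact integrable_of_ae_sub_le hm (continuous_regLog hs)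
  · rw [intervalIntegrable_iff]
    exact hint.integral_prod_left

lemma diffEnergy_regLog_sub {μ ν : Measure ℝ} [IsProbabilityMeasure μ] [IsProbabilityMeasure ν]
    {R : ℝ} (hμ : ∀ᵐ x ∂μ, |x| ≤ R) (hν : ∀ᵐ x ∂ν, |x| ≤ R) {s S : ℝ} (hs : 0 < s) (hS : s ≤ S) :
    diffEnergy μ ν (regLog S) - diffEnergy μ ν (regLog s)
      = ∫ t in s..S, diffEnergy μ ν (fun r => t / (r ^ 2 + t ^ 2)) ∧
    IntervalIntegrable (fun t => diffEnergy μ ν (fun r => t / (r ^ 2 + t ^ 2))) volume s S := by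
  obtain ⟨h1, i1⟩ := integral_regLog_sub (ae_prod_sub_le hμ hμ) hs hS
  obtain ⟨h2, i2⟩ := integral_regLog_sub (ae_prod_sub_le hμ hν) hs hS
  obtain ⟨h3, i3⟩ := integral_regLog_sub (ae_prod_sub_le hν hν) hs hS
  simp only [diffEnergy]
  refine ⟨?_, (i1.sub (i2.const_mul 2)).add i3⟩
  rw [intervalIntegral.integral_add (i1.sub (i2.const_mul 2)) i3,
    intervalIntegral.integral_sub i1 (i2.const_mul 2), intervalIntegral.integral_const_mul,
    ← h1, ← h2, ← h3]
  ring

lemma diffEnergy_poisson_nonneg (μ ν : Measure ℝ) [IsProbabilityMeasure μ]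
    [IsProbabilityMeasure ν] {s : ℝ} (hs : 0 < s) :
    0 ≤ diffEnergy μ ν (fun r => s / (r ^ 2 + s ^ 2)) := by
  rw [diffEnergy_poisson μ ν hs]
  exact integral_nonneg fun u => by positivity

lemma integrableOn_exp_mul_normSq_charFun (μ ν : Measure ℝ) [IsProbabilityMeasure μ]
    [IsProbabilityMeasure ν] {s : ℝ} (hs : 0 < s) :
    IntegrableOn (fun u => Real.exp (-s * u) * ‖charFun μ u - charFun ν u‖ ^ 2) (Ioi 0) := by
  have hexp : IntegrableOn (fun u : ℝ => Real.exp (-s * u) * 4) (Ioi 0) :=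
    (integrableOn_exp_mul_Ioi (by linarith) 0).mul_const 4
  refine hexp.mono' ?_ (ae_of_all _ fun u => ?_)
  · exact (Measurable.mul (by fun_prop)
      (((measurable_charFun.sub measurable_charFun).norm).pow_const 2)).aestronglyMeasurable
  · rw [Real.norm_of_nonneg (by positivity)]
    have : ‖charFun μ u - charFun ν u‖ ≤ 2 := by
      have := norm_sub_le (charFun μ u) (charFun ν u)
      have h1 := norm_charFun_le_one (μ := μ) u
      have h2 := norm_charFun_le_one (μ := ν) u
      linarith
    gcongr
    nlinarith [norm_nonneg (charFun μ u - charFun ν u)]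

lemma diffEnergy_poisson_anti (μ ν : Measure ℝ) [IsProbabilityMeasure μ]
    [IsProbabilityMeasure ν] {s S : ℝ} (hs : 0 < s) (hS : s ≤ S) :
    diffEnergy μ ν (fun r => S / (r ^ 2 + S ^ 2)) ≤
      diffEnergy μ ν (fun r => s / (r ^ 2 + s ^ 2)) := by
  rw [diffEnergy_poisson μ ν hs, diffEnergy_poisson μ ν (hs.trans_le hS)]
  refine setIntegral_mono_on (integrableOn_exp_mul_normSq_charFun μ ν (hs.trans_le hS))
    (integrableOn_exp_mul_normSq_charFun μ ν hs) measurableSet_Ioi fun u hu => ?_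
  have : 0 < u := hu
  gcongr

lemma abs_diffEnergy_regLog_le {μ ν : Measure ℝ} [IsProbabilityMeasure μ] [IsProbabilityMeasure ν]
    {R : ℝ} (hμ : ∀ᵐ x ∂μ, |x| ≤ R) (hν : ∀ᵐ x ∂ν, |x| ≤ R) {s : ℝ} (hs : 0 < s) :
    |diffEnergy μ ν (regLog s)| ≤ 8 * R ^ 2 / s ^ 2 := by
  have key : ∀ (m : Measure (ℝ × ℝ)) [IsProbabilityMeasure m],
      (∀ᵐ p ∂m, |p.1 - p.2| ≤ 2 * R) →
      |∫ p, regLog s (p.1 - p.2) ∂m - Real.log s| ≤ 2 * R ^ 2 / s ^ 2 := by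
    intro m _ hm
    have h1 : ∫ p, regLog s (p.1 - p.2) ∂m - Real.log s
        = ∫ p, (regLog s (p.1 - p.2) - Real.log s) ∂m := by
      rw [integral_sub (integrable_of_ae_sub_le hm (continuous_regLog hs)) (integrable_const _)]
      simp
    rw [h1]
    have h2 := norm_integral_le_of_norm_le_const (μ := m)
      (f := fun p : ℝ × ℝ => regLog s (p.1 - p.2) - Real.log s) (C := 2 * R ^ 2 / s ^ 2) (by
        filter_upwards [hm] with p hp
        refine (abs_regLog_sub_log_le hs _).trans ?_
        have : (p.1 - p.2) ^ 2 ≤ (2 * R) ^ 2 := sq_le_sq' (abs_le.1 hp).1 (abs_le.1 hp).2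
        calc (p.1 - p.2) ^ 2 / (2 * s ^ 2) ≤ (2 * R) ^ 2 / (2 * s ^ 2) := by gcongr
          _ = _ := by field_simp)
    simpa using h2
  have k1 := abs_le.1 (key _ (ae_prod_sub_le hμ hμ))
  have k2 := abs_le.1 (key _ (ae_prod_sub_le hμ hν))
  have k3 := abs_le.1 (key _ (ae_prod_sub_le hν hν))
  have e : 8 * R ^ 2 / s ^ 2 = 4 * (2 * R ^ 2 / s ^ 2) := by ring
  rw [diffEnergy, abs_le, e]
  constructor <;> linarith [k1.1, k1.2, k2.1, k2.2, k3.1, k3.2]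

lemma diffEnergy_regLog_nonpos {μ ν : Measure ℝ} [IsProbabilityMeasure μ] [IsProbabilityMeasure ν]
    {R : ℝ} (hμ : ∀ᵐ x ∂μ, |x| ≤ R) (hν : ∀ᵐ x ∂ν, |x| ≤ R) {s : ℝ} (hs : 0 < s) :
    diffEnergy μ ν (regLog s) ≤ 0 := by
  have hlim : Tendsto (fun S : ℝ => 8 * R ^ 2 / S ^ 2) atTop (nhds 0) :=
    Tendsto.const_div_atTop (tendsto_pow_atTop (by norm_num)) _
  refine ge_of_tendsto hlim ?_
  filter_upwards [eventually_ge_atTop s] with S hS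
  have h1 := (diffEnergy_regLog_sub hμ hν hs hS).1
  have h2 : 0 ≤ ∫ t in s..S, diffEnergy μ ν (fun r => t / (r ^ 2 + t ^ 2)) :=
    intervalIntegral.integral_nonneg hS fun t ht =>
      diffEnergy_poisson_nonneg μ ν (hs.trans_le ht.1)
  have h3 := (abs_le.1 (abs_diffEnergy_regLog_le hμ hν (hs.trans_le hS))).2
  linarith

lemma integral_normSq_charFun_le {μ ν : Measure ℝ} [IsProbabilityMeasure μ]
    [IsProbabilityMeasure ν] {R : ℝ} (hμ : ∀ᵐ x ∂μ, |x| ≤ R) (hν : ∀ᵐ x ∂ν, |x| ≤ R) {s : ℝ}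
    (hs : 0 < s) (hs1 : s ≤ 1) :
    ∫ u in Ioi (0 : ℝ), Real.exp (-2 * u) * ‖charFun μ u - charFun ν u‖ ^ 2
      ≤ -diffEnergy μ ν (regLog s) := by
  rw [← diffEnergy_poisson μ ν two_pos]
  have h0 := (diffEnergy_regLog_sub hμ hν hs hs1).1
  have h0' : 0 ≤ ∫ t in s..1, diffEnergy μ ν (fun r => t / (r ^ 2 + t ^ 2)) :=
    intervalIntegral.integral_nonneg hs1 fun t ht =>
      diffEnergy_poisson_nonneg μ ν (hs.trans_le ht.1)
  obtain ⟨h1, i1⟩ := diffEnergy_regLog_sub hμ hν one_pos one_le_two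
  have h2 := diffEnergy_regLog_nonpos hμ hν two_pos
  have h3 : ∫ _t in (1 : ℝ)..2, diffEnergy μ ν (fun r => 2 / (r ^ 2 + 2 ^ 2))
      ≤ ∫ t in (1 : ℝ)..2, diffEnergy μ ν (fun r => t / (r ^ 2 + t ^ 2)) :=
    intervalIntegral.integral_mono_on one_le_two (by simp) i1 fun t ht =>
      diffEnergy_poisson_anti μ ν (one_pos.trans_le ht.1) ht.2
  rw [intervalIntegral.integral_const] at h3
  norm_num at h3
  norm_num
  linarith

lemma norm_charFun_sub_le {μ : Measure ℝ} [IsProbabilityMeasure μ] {R : ℝ}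
    (hμ : ∀ᵐ x ∂μ, |x| ≤ R) (u v : ℝ) : ‖charFun μ u - charFun μ v‖ ≤ R * |u - v| := by
  have hi : ∀ u : ℝ, Integrable (fun x : ℝ => Complex.exp (u * x * Complex.I)) μ := by
    intro u
    refine Integrable.of_bound (by fun_prop) 1 (ae_of_all _ fun x => ?_)
    rw [show (u : ℂ) * x * Complex.I = ((u * x : ℝ) : ℂ) * Complex.I by push_cast; ring,
      Complex.norm_exp_ofReal_mul_I]
  rw [charFun_apply_real, charFun_apply_real, ← integral_sub (hi u) (hi v)]
  have h2 := norm_integral_le_of_norm_le_const (μ := μ)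
      (f := fun x : ℝ => Complex.exp (u * x * Complex.I) - Complex.exp (v * x * Complex.I))
      (C := R * |u - v|) (by
        filter_upwards [hμ] with x hx
        have e : Complex.exp (u * x * Complex.I) - Complex.exp (v * x * Complex.I)
            = Complex.exp ((v * x : ℝ) * Complex.I) *
              (Complex.exp (Complex.I * ((u - v) * x : ℝ)) - 1) := by
          rw [mul_sub, ← Complex.exp_add]
          push_cast
          ring_nf
        rw [e, norm_mul, Complex.norm_exp_ofReal_mul_I, one_mul]
        refine (Real.norm_exp_I_mul_ofReal_sub_one_le).trans ?_
        rw [Real.norm_eq_abs, abs_mul, mul_comm]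
        gcongr)
  simpa using h2

lemma tendsto_charFun_of_tendsto_integral {μ : ℕ → Measure ℝ} {ν : Measure ℝ}
    [∀ n, IsProbabilityMeasure (μ n)] [IsProbabilityMeasure ν] {R : ℝ} {N : ℕ}
    (hμ : ∀ n ≥ N, ∀ᵐ x ∂(μ n), |x| ≤ R) (hν : ∀ᵐ x ∂ν, |x| ≤ R)
    (h : Tendsto (fun n => ∫ u in Ioi (0 : ℝ),
      Real.exp (-2 * u) * ‖charFun (μ n) u - charFun ν u‖ ^ 2) atTop (nhds 0)) {u : ℝ}
    (hu : 0 ≤ u) : Tendsto (fun n => charFun (μ n) u) atTop (nhds (charFun ν u)) := by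
  rw [tendsto_iff_norm_sub_tendsto_zero, Metric.tendsto_atTop]
  intro η hη
  have hR : 0 ≤ R := by
    obtain ⟨x, hx⟩ := hν.exists
    exact (abs_nonneg x).trans hx
  set d : ℝ := η / (4 * (R + 1)) with hd
  have hd0 : 0 < d := by positivity
  set c : ℝ := d * (Real.exp (-2 * (u + d)) * (η / 2) ^ 2) with hc
  have hc0 : 0 < c := by positivity
  rw [Metric.tendsto_atTop] at h
  obtain ⟨N', hN'⟩ := h c hc0
  refine ⟨max N N', fun n hn => ?_⟩
  have h1 := hN' n ((le_max_right _ _).trans hn)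
  have hμn := hμ n ((le_max_left _ _).trans hn)
  rw [Real.dist_eq, sub_zero] at h1 ⊢
  rw [abs_norm]
  by_contra! hcon
  have hlow : ∀ v ∈ Icc u (u + d), η / 2 ≤ ‖charFun (μ n) v - charFun ν v‖ := by
    intro v hv
    have a1 := norm_charFun_sub_le hμn u v
    have a2 := norm_charFun_sub_le hν u v
    have a3 : |u - v| ≤ d := by rw [abs_le]; constructor <;> linarith [hv.1, hv.2]
    have a4 : R * |u - v| ≤ η / 4 := by
      calc R * |u - v| ≤ (R + 1) * d := by gcongr; linarith
        _ = η / 4 := by rw [hd]; field_simp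
    have a5 : charFun (μ n) u - charFun ν u = (charFun (μ n) u - charFun (μ n) v)
      + (charFun (μ n) v - charFun ν v) - (charFun ν u - charFun ν v) := by ring
    have a6 := norm_sub_le ((charFun (μ n) u - charFun (μ n) v)
      + (charFun (μ n) v - charFun ν v)) (charFun ν u - charFun ν v)
    have a7 := norm_add_le (charFun (μ n) u - charFun (μ n) v) (charFun (μ n) v - charFun ν v)
    rw [← a5] at a6
    linarith
  have hint := integrableOn_exp_mul_normSq_charFun (μ n) ν two_pos
  have hsub : Ioc u (u + d) ⊆ Ioi 0 := fun v hv => lt_of_le_of_lt hu hv.1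
  have b1 : ∫ v in Ioc u (u + d), Real.exp (-2 * v) * ‖charFun (μ n) v - charFun ν v‖ ^ 2
      ≤ ∫ v in Ioi (0 : ℝ), Real.exp (-2 * v) * ‖charFun (μ n) v - charFun ν v‖ ^ 2 :=
    setIntegral_mono_set hint (ae_of_all _ fun v => by positivity)
      hsub.eventuallyLE
  have b2 : ∫ _v in Ioc u (u + d), Real.exp (-2 * (u + d)) * (η / 2) ^ 2
      ≤ ∫ v in Ioc u (u + d), Real.exp (-2 * v) * ‖charFun (μ n) v - charFun ν v‖ ^ 2 := by
    refine setIntegral_mono_on (integrableOn_const measure_Ioc_lt_top.ne) (hint.mono_set hsub)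
      measurableSet_Ioc fun v hv => ?_
    have := hlow v ⟨hv.1.le, hv.2⟩
    have : -2 * (u + d) ≤ -2 * v := by linarith [hv.2]
    gcongr
  have b3 : ∫ _v in Ioc u (u + d), Real.exp (-2 * (u + d)) * (η / 2) ^ 2 = c := by
    rw [setIntegral_const]
    simp [hc, hd0.le]
  rw [b3] at b2
  have := (abs_lt.1 h1).2
  linarith

/-- Weak convergence from vanishing of the weighted `L²` distance of characteristic functions. -/
lemma tendsto_integral_of_charFun {μ : ℕ → Measure ℝ} {ν : Measure ℝ}
    [∀ n, IsProbabilityMeasure (μ n)] [IsProbabilityMeasure ν] {R : ℝ} {N : ℕ}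
    (hμ : ∀ n ≥ N, ∀ᵐ x ∂(μ n), |x| ≤ R) (hν : ∀ᵐ x ∂ν, |x| ≤ R)
    (h : Tendsto (fun n => ∫ u in Ioi (0 : ℝ),
      Real.exp (-2 * u) * ‖charFun (μ n) u - charFun ν u‖ ^ 2) atTop (nhds 0))
    {f : ℝ → ℝ} (hf : Continuous f) {M : ℝ} (hM : ∀ x, |f x| ≤ M) :
    Tendsto (fun n => ∫ x, f x ∂(μ n)) atTop (nhds (∫ x, f x ∂ν)) := by
  have key : Tendsto (β := ProbabilityMeasure ℝ) (fun n => ⟨μ n, inferInstance⟩) atTop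
      (nhds ⟨ν, inferInstance⟩) := by
    refine ProbabilityMeasure.tendsto_iff_tendsto_charFun.2 fun u => ?_
    rcases le_total 0 u with hu | hu
    · exact tendsto_charFun_of_tendsto_integral hμ hν h hu
    · have h1 := tendsto_charFun_of_tendsto_integral hμ hν h (neg_nonneg.2 hu)
      have h2 := (Complex.continuous_conj.tendsto _).comp h1
      simp only [Function.comp_def, charFun_neg, Complex.conj_conj] at h2
      exact h2
  exact ProbabilityMeasure.tendsto_iff_forall_integral_tendsto.1 key
    (BoundedContinuousFunction.ofNormedAddCommGroup f hf M hM)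

/-- The defect `log √(1 + u²) - log |u|`. -/
noncomputable def logDefect (u : ℝ) : ℝ := 1 / 2 * Real.log (1 + (u ^ 2)⁻¹)

lemma logDefect_nonneg (u : ℝ) : 0 ≤ logDefect u :=
  mul_nonneg (by norm_num) (Real.log_nonneg (by linarith [inv_nonneg.2 (sq_nonneg u)]))

lemma measurable_logDefect : Measurable logDefect := by
  unfold logDefect
  fun_prop

lemma integrable_logDefect : Integrable logDefect := by
  have h1 : IntegrableOn (fun u : ℝ => Real.log 2 + |Real.log u|) (Icc (-1) 1) := by
    rw [integrableOn_Icc_iff_integrableOn_Ioc,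
      ← intervalIntegrable_iff_integrableOn_Ioc_of_le (by norm_num)]
    exact intervalIntegrable_const.add intervalIntegral.intervalIntegrable_log'.abs
  refine (integrable_inv_one_add_sq.add (h1.integrable_indicator measurableSet_Icc)).mono'
    measurable_logDefect.aestronglyMeasurable ?_
  refine ae_of_all _ fun u => ?_
  rw [Real.norm_of_nonneg (logDefect_nonneg u)]
  simp only [Pi.add_apply]
  by_cases hu : u ∈ Icc (-1 : ℝ) 1
  · rw [indicator_of_mem hu]
    have h0 : 0 ≤ (1 + u ^ 2)⁻¹ := by positivity
    rcases eq_or_ne u 0 with rfl | hne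
    · simp [logDefect]
      positivity
    have hle : u ^ 2 ≤ 1 := by nlinarith [hu.1, hu.2]
    have hu2 : 0 < u ^ 2 := by positivity
    have : Real.log (1 + (u ^ 2)⁻¹) ≤ Real.log 2 - 2 * Real.log u := by
      have e : 1 + (u ^ 2)⁻¹ = (u ^ 2 + 1) / u ^ 2 := by field_simp
      rw [e, Real.log_div (by positivity) (by positivity), Real.log_pow]
      have := Real.log_le_log (by positivity : 0 < u ^ 2 + 1) (by linarith : u ^ 2 + 1 ≤ 2)
      push_cast
      linarith
    have h2 := neg_abs_le (Real.log u)
    have h3 : 0 ≤ Real.log 2 := Real.log_nonneg (by norm_num)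
    rw [logDefect]
    linarith
  · rw [indicator_of_notMem hu, add_zero]
    have hge : 1 ≤ u ^ 2 := by
      by_contra! hlt
      exact hu ⟨by nlinarith, by nlinarith⟩
    have := Real.log_le_sub_one_of_pos (show 0 < 1 + (u ^ 2)⁻¹ by positivity)
    have h3 : 1 / 2 * (u ^ 2)⁻¹ ≤ (1 + u ^ 2)⁻¹ := by
      rw [← one_div, ← one_div, div_mul_div_comm, div_le_div_iff₀ (by positivity) (by positivity)]
      linarith
    rw [logDefect]
    linarith

lemma log_abs_le_regLog (s : ℝ) {u : ℝ} (hu : u ≠ 0) :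
    Real.log |u| ≤ regLog s u := by
  have : Real.log |u| = 1 / 2 * Real.log (u ^ 2) := by
    rw [Real.log_pow, Real.log_abs]; push_cast; ring
  rw [this, regLog]
  have h2 : 0 < u ^ 2 := by positivity
  have := Real.log_le_log h2 (by nlinarith [sq_nonneg s] : u ^ 2 ≤ u ^ 2 + s ^ 2)
  linarith

lemma log_le_regLog {s : ℝ} (hs : 0 < s) (u : ℝ) : Real.log s ≤ regLog s u := by
  have : Real.log s = 1 / 2 * Real.log (s ^ 2) := by
    rw [Real.log_pow]; push_cast; ring
  rw [this, regLog]
  have h2 : 0 < s ^ 2 := by positivity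
  have := Real.log_le_log h2 (by nlinarith [sq_nonneg u] : s ^ 2 ≤ u ^ 2 + s ^ 2)
  linarith

lemma regLog_sub_log_abs_le {s : ℝ} (hs : 0 < s) {u v : ℝ} (hv : v ≠ 0) (huv : |v| ≤ |u|) :
    regLog s u - Real.log |u| ≤ logDefect (v / s) := by
  have hu : u ≠ 0 := abs_pos.1 ((abs_pos.2 hv).trans_le huv)
  have h1 : Real.log |u| = 1 / 2 * Real.log (u ^ 2) := by
    rw [Real.log_pow, Real.log_abs]; push_cast; ring
  have h2 : u ^ 2 + s ^ 2 = u ^ 2 * (1 + s ^ 2 / u ^ 2) := by field_simp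
  have h3 : v ^ 2 ≤ u ^ 2 := sq_le_sq.2 huv
  have h4 : 1 + s ^ 2 / u ^ 2 ≤ 1 + ((v / s) ^ 2)⁻¹ := by
    rw [div_pow, inv_div]
    have : 0 < v ^ 2 := by positivity
    gcongr
  rw [regLog, h1, h2, Real.log_mul (by positivity) (by positivity), logDefect]
  have := Real.log_le_log (by positivity) h4
  linarith

/-- The kernel `(x - z)(eˣ - eᶻ)`. -/
noncomputable def biKernel (x z : ℝ) : ℝ := (x - z) * (Real.exp x - Real.exp z)

lemma biKernel_nonneg (x z : ℝ) : 0 ≤ biKernel x z := by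
  rcases le_total x z with h | h
  · exact mul_nonneg_of_nonpos_of_nonpos (by linarith) (by linarith [Real.exp_le_exp.2 h])
  · exact mul_nonneg (by linarith) (by linarith [Real.exp_le_exp.2 h])

lemma biKernel_pos {x z : ℝ} (h : x ≠ z) : 0 < biKernel x z := by
  refine (biKernel_nonneg x z).lt_of_ne' (mul_ne_zero (sub_ne_zero.2 h) (sub_ne_zero.2 ?_))
  exact fun h' => h (Real.exp_injective h')

lemma log_biKernel (x z : ℝ) :
    Real.log (biKernel x z) = Real.log |x - z| + Real.log |Real.exp x - Real.exp z| := by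
  rcases eq_or_ne x z with rfl | h
  · simp [biKernel]
  · rw [Real.log_abs, Real.log_abs, biKernel, Real.log_mul (sub_ne_zero.2 h)
      (sub_ne_zero.2 fun h' => h (Real.exp_injective h'))]

lemma continuous_biKernel_left (z : ℝ) : Continuous fun x => biKernel x z := by
  unfold biKernel
  fun_prop

lemma intervalIntegrable_log_biKernel (a b z : ℝ) :
    IntervalIntegrable (fun t => Real.log (biKernel t z)) volume a b := by
  have h : MeromorphicOn (fun t => biKernel t z) (uIcc a b) := by
    intro t _
    refine AnalyticAt.meromorphicAt ?_
    unfold biKernel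
    fun_prop
  refine h.intervalIntegrable_log_norm.congr fun t _ => ?_
  simp [Real.log_abs]

lemma exp_max_mul_le_abs_exp_sub (x z : ℝ) :
    Real.exp (max x z) * (|x - z| / (1 + |x - z|)) ≤ |Real.exp x - Real.exp z| := by
  wlog h : z ≤ x generalizing x z
  · rw [max_comm, abs_sub_comm x z, abs_sub_comm (Real.exp x)]
    exact this z x (le_of_not_ge h)
  rw [max_eq_left h, abs_of_nonneg (sub_nonneg.2 h), abs_of_nonneg
    (sub_nonneg.2 (Real.exp_le_exp.2 h))]
  have h1 : Real.exp z = Real.exp x * Real.exp (-(x - z)) := by rw [← Real.exp_add]; ring_nf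
  have h2 : Real.exp (-(x - z)) ≤ 1 / (1 + (x - z)) := by
    rw [Real.exp_neg, ← one_div]
    have h3 := Real.add_one_le_exp (x - z)
    exact one_div_le_one_div_of_le (by linarith) (by linarith)
  have h4 : (x - z) / (1 + (x - z)) = 1 - 1 / (1 + (x - z)) := by
    have : 1 + (x - z) ≠ 0 := by linarith
    field_simp
    ring
  rw [h1, h4]
  nlinarith [Real.exp_pos x]

lemma max_add_log_sub_le_log_biKernel {t z : ℝ} (h : t ≠ z) :
    max t z + Real.log (1 + |t - z|) - Real.log 2 - 2 * logDefect (t - z)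
      ≤ Real.log (biKernel t z) := by
  have hu : 0 < |t - z| := abs_pos.2 (sub_ne_zero.2 h)
  have h1 := Real.log_le_log (by positivity) (exp_max_mul_le_abs_exp_sub t z)
  rw [Real.log_mul (by positivity) (by positivity), Real.log_exp,
    Real.log_div (by positivity) (by positivity)] at h1
  have h2 := regLog_sub_log_abs_le one_pos (sub_ne_zero.2 h) le_rfl
  rw [div_one] at h2
  have h3 : Real.log (1 + |t - z|) - 1 / 2 * Real.log 2 ≤ regLog 1 (t - z) := by
    have e : Real.log (1 + |t - z|) = 1 / 2 * Real.log ((1 + |t - z|) ^ 2) := by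
      rw [Real.log_pow]; push_cast; ring
    have : Real.log ((1 + |t - z|) ^ 2) ≤ Real.log (2 * ((t - z) ^ 2 + 1 ^ 2)) := by
      refine Real.log_le_log (by positivity) ?_
      rw [← sq_abs (t - z)]
      nlinarith [sq_nonneg (1 - |t - z|)]
    rw [Real.log_mul (by norm_num) (by positivity)] at this
    have h5 := mul_le_mul_of_nonneg_left this (by norm_num : (0 : ℝ) ≤ 1 / 2)
    rw [mul_add, ← e] at h5
    rw [regLog]
    exact sub_le_iff_le_add'.2 h5
  rw [log_biKernel]
  linarith

lemma biKernel_le (x z : ℝ) :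
    biKernel x z ≤ (1 + |x|) * (1 + |z|) * Real.exp (|x| + max z 0) := by
  have h1 : |x - z| ≤ (1 + |x|) * (1 + |z|) := by
    have := abs_sub x z
    nlinarith [abs_nonneg x, abs_nonneg z, mul_nonneg (abs_nonneg x) (abs_nonneg z)]
  have h2 : |Real.exp x - Real.exp z| ≤ Real.exp (|x| + max z 0) := by
    have e1 : Real.exp x ≤ Real.exp (|x| + max z 0) :=
      Real.exp_le_exp.2 (by linarith [le_abs_self x, le_max_right z 0])
    have e2 : Real.exp z ≤ Real.exp (|x| + max z 0) :=
      Real.exp_le_exp.2 (by linarith [abs_nonneg x, le_max_left z 0])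
    rw [abs_le]
    constructor <;> linarith [Real.exp_pos x, Real.exp_pos z]
  calc biKernel x z = |x - z| * |Real.exp x - Real.exp z| := by
        rw [← abs_mul]; exact (abs_of_nonneg (biKernel_nonneg x z)).symm
    _ ≤ _ := by gcongr

/-- `ρ` is a probability measure on `[a, b]` whose density is bounded by `M`. -/
structure BoundedDensity (ρ : Measure ℝ) (a b M : ℝ) : Prop where
  prob : IsProbabilityMeasure ρ
  pos : 0 < M
  le : ρ ≤ ENNReal.ofReal M • volume.restrict (Icc a b)

namespace BoundedDensity

variable {ρ : Measure ℝ} {a b M : ℝ}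

lemma ae_of_ae_restrict (h : BoundedDensity ρ a b M) {p : ℝ → Prop}
    (hp : ∀ᵐ x ∂(volume.restrict (Icc a b)), p x) : ∀ᵐ x ∂ρ, p x := by
  have : ρ ≪ volume.restrict (Icc a b) :=
    (Measure.absolutelyContinuous_of_le h.le).trans Measure.smul_absolutelyContinuous
  exact this.ae_le hp

lemma ae_mem (h : BoundedDensity ρ a b M) : ∀ᵐ x ∂ρ, x ∈ Icc a b :=
  h.ae_of_ae_restrict (ae_restrict_mem measurableSet_Icc)

lemma ae_ne (h : BoundedDensity ρ a b M) (z : ℝ) : ∀ᵐ x ∂ρ, x ≠ z :=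
  h.ae_of_ae_restrict (ae_restrict_of_ae (by simp [ae_iff]))

lemma integrable (h : BoundedDensity ρ a b M) {f : ℝ → ℝ} (hf : IntegrableOn f (Icc a b)) :
    Integrable f ρ :=
  (hf.smul_measure ENNReal.ofReal_ne_top).mono_measure h.le

lemma integrable_of_intervalIntegrable (h : BoundedDensity ρ a b M) {f : ℝ → ℝ} (hab : a ≤ b)
    (hf : IntervalIntegrable f volume a b) : Integrable f ρ :=
  h.integrable (by
    rwa [integrableOn_Icc_iff_integrableOn_Ioc, ← intervalIntegrable_iff_integrableOn_Ioc_of_le hab])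

lemma integrable_of_continuous (h : BoundedDensity ρ a b M) {f : ℝ → ℝ} (hf : Continuous f) :
    Integrable f ρ :=
  h.integrable (hf.continuousOn.integrableOn_compact isCompact_Icc)

lemma integral_le (h : BoundedDensity ρ a b M) {f : ℝ → ℝ} (hf0 : ∀ x, 0 ≤ f x)
    (hf : IntegrableOn f (Icc a b)) : ∫ x, f x ∂ρ ≤ M * ∫ x in Icc a b, f x := by
  have := integral_mono_measure h.le (ae_of_all _ hf0) (hf.smul_measure ENNReal.ofReal_ne_top)
  rwa [integral_smul_measure, ENNReal.toReal_ofReal h.pos.le, smul_eq_mul] at this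

lemma ae_abs_le (h : BoundedDensity ρ a b M) {R : ℝ} (ha : |a| ≤ R) (hb : |b| ≤ R) :
    ∀ᵐ x ∂ρ, |x| ≤ R := by
  filter_upwards [h.ae_mem] with x hx
  exact (abs_le_max_abs_abs hx.1 hx.2).trans (max_le ha hb)

lemma integral_logDefect_le (h : BoundedDensity ρ a b M) {s : ℝ} (hs : 0 < s) (z : ℝ) :
    Integrable (fun t => logDefect ((t - z) / s)) ρ ∧
    ∫ t, logDefect ((t - z) / s) ∂ρ ≤ M * (s * ∫ u, logDefect u) := by
  have hi : Integrable (fun t => logDefect ((t - z) / s)) :=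
    (integrable_logDefect.comp_div hs.ne').comp_sub_right z
  refine ⟨h.integrable hi.integrableOn, ?_⟩
  refine (h.integral_le (fun t => logDefect_nonneg _) hi.integrableOn).trans ?_
  refine mul_le_mul_of_nonneg_left ?_ h.pos.le
  refine (setIntegral_le_integral hi (ae_of_all _ fun t => logDefect_nonneg _)).trans ?_
  rw [integral_sub_right_eq_self (fun t => logDefect (t / s)), Measure.integral_comp_div,
    abs_of_pos hs, smul_eq_mul]

end BoundedDensity

/-- Minus the equilibrium potential of `ρ` for the kernel `biKernel`. -/
noncomputable def logPotential (ρ : Measure ℝ) (z : ℝ) : ℝ := ∫ t, Real.log (biKernel t z) ∂ρ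

lemma BoundedDensity.integrable_log_biKernel {ρ : Measure ℝ} {a b M : ℝ}
    (h : BoundedDensity ρ a b M) (hab : a ≤ b) (z : ℝ) :
    Integrable (fun t => Real.log (biKernel t z)) ρ :=
  h.integrable_of_intervalIntegrable hab (intervalIntegrable_log_biKernel a b z)

lemma exists_biKernel_le_exp {ρ : Measure ℝ} {a b M : ℝ} (h : BoundedDensity ρ a b M)
    (hab : a ≤ b) :
    ∃ C, 0 ≤ C ∧ ∀ x z, biKernel x z ≤ Real.exp (2 * |x| + C + logPotential ρ z) := by
  have := h.prob
  set R := max |a| |b| with hR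
  have hR0 : 0 ≤ R := (abs_nonneg a).trans (le_max_left _ _)
  set I := ∫ u, logDefect u
  have hI : 0 ≤ I := integral_nonneg logDefect_nonneg
  refine ⟨R + Real.log (1 + R) + Real.log 2 + 2 * (M * (1 * I)), ?_, fun x z => ?_⟩
  · have := Real.log_nonneg (by linarith : (1 : ℝ) ≤ 1 + R)
    have := Real.log_nonneg (by norm_num : (1 : ℝ) ≤ 2)
    have := h.pos
    positivity
  obtain ⟨hd1, hd2⟩ := h.integral_logDefect_le one_pos z
  simp only [div_one] at hd1 hd2
  have hlow : (max z 0 - R + (Real.log (1 + |z|) - Real.log (1 + R)) - Real.log 2)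
      - 2 * ∫ t, logDefect (t - z) ∂ρ ≤ logPotential ρ z := by
    have e : (max z 0 - R + (Real.log (1 + |z|) - Real.log (1 + R)) - Real.log 2)
      - 2 * ∫ t, logDefect (t - z) ∂ρ = ∫ t, ((max z 0 - R + (Real.log (1 + |z|)
        - Real.log (1 + R)) - Real.log 2) - 2 * logDefect (t - z)) ∂ρ := by
      rw [integral_sub (integrable_const _) (hd1.const_mul 2), integral_const_mul]
      simp
    rw [e]
    refine integral_mono_ae ((integrable_const _).sub (hd1.const_mul 2))
      (h.integrable_log_biKernel hab z) ?_
    filter_upwards [h.ae_ne z, h.ae_abs_le (le_max_left _ _) (le_max_right _ _)] with t ht htR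
    rw [← hR] at htR
    refine le_trans ?_ (max_add_log_sub_le_log_biKernel ht)
    have h1 : max z 0 - R ≤ max t z := by
      rcases max_cases z 0 with h' | h' <;> rcases max_cases t z with h'' | h'' <;>
        linarith [(abs_le.1 htR).1]
    have h2 : Real.log (1 + |z|) ≤ Real.log (1 + R) + Real.log (1 + |t - z|) := by
      rw [← Real.log_mul (by positivity) (by positivity)]
      refine Real.log_le_log (by positivity) ?_
      have : |z| ≤ |t| + |t - z| := by
        have := abs_sub t (t - z)
        simpa using this
      nlinarith [abs_nonneg (t - z), mul_nonneg hR0 (abs_nonneg (t - z))]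
    linarith
  rcases (biKernel_nonneg x z).eq_or_lt with h0 | h0
  · rw [← h0]; exact (Real.exp_pos _).le
  rw [← Real.log_le_iff_le_exp h0]
  refine (Real.log_le_log h0 (biKernel_le x z)).trans ?_
  rw [Real.log_mul (by positivity) (by positivity), Real.log_mul (by positivity) (by positivity),
    Real.log_exp]
  have h3 := Real.log_le_sub_one_of_pos (show 0 < 1 + |x| by positivity)
  linarith

/-- Jensen's inequality for the weighted products of kernels. -/
lemma exp_sum_logPotential_le {ρ : Measure ℝ} {a b M : ℝ} (h : BoundedDensity ρ a b M)
    (hab : a ≤ b) {V : ℝ → ℝ} (hV : Continuous V) {ι : Type*} (S : Finset ι) (z : ι → ℝ) (N : ℝ) :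
    Real.exp (∑ j ∈ S, logPotential ρ (z j) - N * ∫ t, V t ∂ρ)
      ≤ M * ∫ t in Icc a b, (∏ j ∈ S, biKernel t (z j)) * Real.exp (-N * V t) := by
  have := h.prob
  have hc : Continuous fun t => (∏ j ∈ S, biKernel t (z j)) * Real.exp (-N * V t) :=
    (continuous_finsetProd _ fun j _ => continuous_biKernel_left (z j)).mul (by fun_prop)
  refine le_trans ?_ (h.integral_le (fun t => mul_nonneg
    (Finset.prod_nonneg fun j _ => biKernel_nonneg _ _) (Real.exp_pos _).le)
    (hc.continuousOn.integrableOn_compact isCompact_Icc))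
  set f : ℝ → ℝ := fun t => ∑ j ∈ S, Real.log (biKernel t (z j)) - N * V t with hf
  have hi1 : Integrable (fun t => ∑ j ∈ S, Real.log (biKernel t (z j))) ρ :=
    integrable_finsetSum _ fun j _ => h.integrable_log_biKernel hab (z j)
  have hi2 : Integrable (fun t => N * V t) ρ := (h.integrable_of_continuous hV).const_mul N
  have hfi : Integrable f ρ := hi1.sub hi2
  have hae : ∀ᵐ t ∂ρ, Real.exp (f t) = (∏ j ∈ S, biKernel t (z j)) * Real.exp (-N * V t) := by
    have h1 : ∀ᵐ t ∂ρ, ∀ j ∈ S, t ≠ z j := by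
      rw [Filter.eventually_all_finset]
      exact fun j _ => h.ae_ne (z j)
    filter_upwards [h1] with t ht
    rw [hf]
    simp only
    rw [sub_eq_add_neg, Real.exp_add, Real.exp_sum, neg_mul]
    congr 1
    exact Finset.prod_congr rfl fun j hj => Real.exp_log (biKernel_pos (ht j hj))
  have hj := convexOn_exp.map_integral_le Real.continuous_exp.continuousOn isClosed_univ
    (ae_of_all ρ fun t => mem_univ (f t)) hfi ((integrable_congr hae).2
      (h.integrable_of_continuous hc))
  rw [integral_congr_ae hae] at hj
  have e : ∫ t, f t ∂ρ = ∑ j ∈ S, logPotential ρ (z j) - N * ∫ t, V t ∂ρ := by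
    rw [hf, integral_sub hi1 hi2, integral_const_mul,
      integral_finsetSum _ fun j _ => h.integrable_log_biKernel hab (z j)]
    rfl
  rw [e] at hj
  exact hj

lemma integral_exp_neg_abs : ∫ x : ℝ, Real.exp (-|x|) = 2 := by
  rw [integral_comp_abs (f := fun x => Real.exp (-x)), integral_exp_neg_Ioi_zero]
  norm_num

lemma integrable_exp_neg_abs : Integrable fun x : ℝ => Real.exp (-|x|) :=
  Integrable.of_integral_ne_zero (by rw [integral_exp_neg_abs]; norm_num)

/-- Every finite family of at least two points of `[-R, R]` admits a choice of partners at total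
distance at most `4 * R`. -/
lemma exists_partner {n : ℕ} (hn : 2 ≤ n) (z : Fin n → ℝ) {R : ℝ} (hz : ∀ j, |z j| ≤ R) :
    ∃ l : Fin n → Fin n, (∀ k, l k ≠ k) ∧ ∑ k, |z k - z (l k)| ≤ 4 * R := by
  obtain ⟨m, rfl⟩ := Nat.exists_eq_add_of_le' hn
  set σ := Tuple.sort z
  have hmono : Monotone (z ∘ σ) := Tuple.monotone_sort z
  set t : Fin (m + 2) → Fin (m + 2) :=
    Fin.lastCases (Fin.castSucc (Fin.last m)) fun i => i.succ with ht
  have ht1 (i : Fin (m + 1)) : t i.castSucc = i.succ := by simp [ht]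
  have ht2 : t (Fin.last (m + 1)) = Fin.castSucc (Fin.last m) := by simp [ht]
  have htne (i) : t i ≠ i := by
    refine Fin.lastCases ?_ (fun j => ?_) i
    · rw [ht2]
      exact (Fin.castSucc_lt_last _).ne
    · rw [ht1]
      exact (Fin.castSucc_lt_succ).ne'
  refine ⟨fun k => σ (t (σ.symm k)), fun k h => htne (σ.symm k) (σ.injective (by simpa using h)), ?_⟩
  rw [← Equiv.sum_comp σ]
  simp only [Equiv.symm_apply_apply]
  rw [Fin.sum_univ_castSucc]
  simp only [ht1, ht2]
  have e : ∀ i : Fin (m + 1), |z (σ i.castSucc) - z (σ i.succ)|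
      = z (σ i.succ) - z (σ i.castSucc) := fun i => by
    rw [abs_sub_comm, abs_of_nonneg]
    exact sub_nonneg.2 (hmono (Fin.castSucc_lt_succ).le)
  simp only [e]
  have hs := Fin.sum_univ_succ (fun i => z (σ i))
  have hc := Fin.sum_univ_castSucc (fun i => z (σ i))
  rw [Finset.sum_sub_distrib]
  have h1 := abs_le.1 (hz (σ 0))
  have h2 := abs_le.1 (hz (σ (Fin.last (m + 1))))
  have h3 := abs_sub (z (σ (Fin.last (m + 1)))) (z (σ (Fin.castSucc (Fin.last m))))
  have h4 := hz (σ (Fin.last (m + 1)))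
  have h5 := hz (σ (Fin.castSucc (Fin.last m)))
  linarith

/-- Continuous functions of at most exponential growth. -/
def ExpBounded (f : ℝ → ℝ) : Prop :=
  Continuous f ∧ ∃ C A : ℝ, ∀ x, |f x| ≤ C * Real.exp (A * |x|)

namespace ExpBounded

variable {f g : ℝ → ℝ}

lemma const (c : ℝ) : ExpBounded fun _ => c :=
  ⟨continuous_const, |c|, 0, fun x => by simp⟩

lemma mul (hf : ExpBounded f) (hg : ExpBounded g) : ExpBounded fun x => f x * g x := by
  obtain ⟨hf, C, A, h⟩ := hf
  obtain ⟨hg, D, B, k⟩ := hg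
  refine ⟨hf.mul hg, C * D, A + B, fun x => ?_⟩
  rw [abs_mul, add_mul, Real.exp_add, mul_mul_mul_comm]
  exact mul_le_mul (h x) (k x) (abs_nonneg _) ((abs_nonneg _).trans (h x))

lemma prod {ι : Type*} (S : Finset ι) {f : ι → ℝ → ℝ} (hf : ∀ i ∈ S, ExpBounded (f i)) :
    ExpBounded fun x => ∏ i ∈ S, f i x := by
  classical
  induction S using Finset.induction_on with
  | empty => simpa using const 1
  | insert i S hi ih =>
    simp only [Finset.prod_insert hi]
    exact (hf i (by simp)).mul (ih fun j hj => hf j (by simp [hj]))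

lemma pow (hf : ExpBounded f) (k : ℕ) : ExpBounded fun x => f x ^ k := by
  simpa using prod (Finset.range k) (f := fun _ => f) fun _ _ => hf

lemma sub_const (hf : ExpBounded f) (c : ℝ) : ExpBounded fun x => f x - c := by
  obtain ⟨hf, C, A, h⟩ := hf
  refine ⟨hf.sub continuous_const, C + |c|, |A|, fun x => ?_⟩
  have hC : 0 ≤ C := by simpa using (abs_nonneg _).trans (h 0)
  have h1 : Real.exp (A * |x|) ≤ Real.exp (|A| * |x|) :=
    Real.exp_le_exp.2 (mul_le_mul_of_nonneg_right (le_abs_self A) (abs_nonneg x))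
  have h2 : 1 ≤ Real.exp (|A| * |x|) := Real.one_le_exp (by positivity)
  nlinarith [abs_sub (f x) c, h x, abs_nonneg c]

end ExpBounded

/-- The external field grows faster than every linear function. -/
def Superlinear (V : ℝ → ℝ) : Prop := ∀ A : ℝ, ∃ C : ℝ, ∀ x, A * |x| - C ≤ V x

lemma superlinear_of_tendsto {V : ℝ → ℝ} (hV : Continuous V)
    (h1 : Tendsto (fun x => V x / (|x| + 1)) atTop atTop)
    (h2 : Tendsto (fun x => V x / (|x| + 1)) atBot atTop) : Superlinear V := by
  intro A
  have hc : Continuous fun x => V x - A * |x| := by fun_prop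
  obtain ⟨T, hT⟩ := eventually_atTop.1 (h1.eventually_ge_atTop |A|)
  obtain ⟨B, hB⟩ := eventually_atBot.1 (h2.eventually_ge_atTop |A|)
  have key (x : ℝ) (hx : |A| ≤ V x / (|x| + 1)) : A * |x| ≤ V x := by
    rw [le_div_iff₀ (by positivity)] at hx
    nlinarith [mul_le_mul_of_nonneg_right (le_abs_self A) (abs_nonneg x), abs_nonneg A]
  obtain ⟨C, hC⟩ := (isCompact_Icc (a := B) (b := T)).bddBelow_image hc.continuousOn
  refine ⟨|C|, fun x => ?_⟩
  by_cases hx : x ∈ Icc B T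
  · have := hC (mem_image_of_mem _ hx)
    linarith [neg_abs_le C]
  · have : A * |x| ≤ V x := by
      rcases le_or_gt x B with h | h
      · exact key x (hB x h)
      · exact key x (hT x (by by_contra! h'; exact hx ⟨h.le, h'.le⟩))
    linarith [abs_nonneg C]

lemma ExpBounded.integrable {f V : ℝ → ℝ} (hf : ExpBounded f) (hV : Continuous V)
    (hs : Superlinear V) {n : ℕ} (hn : 1 ≤ n) :
    Integrable fun x => f x * Real.exp (-(n : ℝ) * V x) := by
  obtain ⟨hf, C, A, h⟩ := hf
  obtain ⟨D, hD⟩ := hs (|A| + 1)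
  have hC : 0 ≤ C := by simpa using (abs_nonneg _).trans (h 0)
  have hn' : (1 : ℝ) ≤ n := by exact_mod_cast hn
  refine (integrable_exp_neg_abs.const_mul (C * Real.exp (n * D))).mono'
    (by fun_prop) (ae_of_all _ fun x => ?_)
  rw [Real.norm_eq_abs, abs_mul, Real.abs_exp, mul_assoc, ← Real.exp_add]
  refine (mul_le_mul_of_nonneg_right (h x) (Real.exp_pos _).le).trans ?_
  rw [mul_assoc, ← Real.exp_add]
  refine mul_le_mul_of_nonneg_left (Real.exp_le_exp.2 ?_) hC
  have h1 := mul_le_mul_of_nonneg_left (hD x) (by positivity : (0 : ℝ) ≤ n)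
  have h2 : 0 ≤ (n - 1) * ((|A| + 1) * |x|) := mul_nonneg (by linarith) (by positivity)
  have h3 := mul_le_mul_of_nonneg_right (le_abs_self A) (abs_nonneg x)
  linarith

/-- A pair of increasing functions whose increments multiply to `biKernel`: up to order, the
identity and the exponential. -/
structure AdmissiblePair (α β : ℝ → ℝ) : Prop where
  continuous_left : Continuous α
  continuous_right : Continuous β
  strictMono : StrictMono α
  mul_eq : ∀ x z, (α x - α z) * (β x - β z) = biKernel x z
  left_le : ∀ x, |α x| ≤ Real.exp |x|
  right_le : ∀ x, |β x| ≤ Real.exp |x|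

lemma abs_le_exp_abs (x : ℝ) : |x| ≤ Real.exp |x| := by
  linarith [Real.add_one_le_exp |x|]

lemma abs_exp_le_exp_abs (x : ℝ) : |Real.exp x| ≤ Real.exp |x| := by
  rw [Real.abs_exp]
  exact Real.exp_le_exp.2 (le_abs_self x)

lemma admissiblePair_id_exp : AdmissiblePair (fun x => x) Real.exp :=
  ⟨continuous_id, Real.continuous_exp, strictMono_id, fun _ _ => rfl, abs_le_exp_abs,
    abs_exp_le_exp_abs⟩

lemma admissiblePair_exp_id : AdmissiblePair Real.exp fun x => x :=
  ⟨Real.continuous_exp, continuous_id, Real.exp_strictMono, fun _ _ => mul_comm _ _,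
    abs_exp_le_exp_abs, abs_le_exp_abs⟩

lemma AdmissiblePair.expBounded_left {α β : ℝ → ℝ} (h : AdmissiblePair α β) : ExpBounded α :=
  ⟨h.continuous_left, 1, 1, fun x => by simpa using h.left_le x⟩

lemma AdmissiblePair.expBounded_right {α β : ℝ → ℝ} (h : AdmissiblePair α β) : ExpBounded β :=
  ⟨h.continuous_right, 1, 1, fun x => by simpa using h.right_le x⟩

/-- The polynomial in `α` with zeros `α (z j)` is orthogonal, for the weight `e^{-nV}`, to all
polynomials in `β` of smaller degree with zeros among the `β (z j)`. -/
def Biorthogonal (α β V : ℝ → ℝ) {n : ℕ} (z : Fin n → ℝ) : Prop :=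
  ∀ S : Finset (Fin n), S ≠ Finset.univ →
    ∫ x, (∏ j, (α x - α (z j))) * (∏ j ∈ S, (β x - β (z j))) * Real.exp (-(n : ℝ) * V x) = 0

lemma AdmissiblePair.biorthogonal {α β V : ℝ → ℝ} (h : AdmissiblePair α β) (hV : Continuous V)
    (hs : Superlinear V) {n : ℕ} (hn : 1 ≤ n) {z : Fin n → ℝ}
    (hz : ∀ k < n, ∫ x, (∏ j, (α x - α (z j))) * β x ^ k * Real.exp (-(n : ℝ) * V x) = 0) :
    Biorthogonal α β V z := by
  intro S hS
  have hcard : S.card < n := by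
    simpa using Finset.card_lt_card (Finset.ssubset_univ_iff.2 hS)
  set P : Polynomial ℝ := ∏ j ∈ S, (Polynomial.X - Polynomial.C (β (z j))) with hP
  have hdeg : P.natDegree = S.card := by
    rw [hP, Polynomial.natDegree_prod_of_monic _ _ fun j _ => Polynomial.monic_X_sub_C _]
    simp
  have heval (x : ℝ) : ∏ j ∈ S, (β x - β (z j)) = ∑ i ∈ Finset.range (S.card + 1),
      P.coeff i * β x ^ i := by
    rw [← hdeg, ← Polynomial.eval_eq_sum_range, hP, Polynomial.eval_prod]
    simp
  have e : (fun x => (∏ j, (α x - α (z j))) * (∏ j ∈ S, (β x - β (z j)))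
      * Real.exp (-(n : ℝ) * V x)) = fun x => ∑ i ∈ Finset.range (S.card + 1),
      P.coeff i * ((∏ j, (α x - α (z j))) * β x ^ i * Real.exp (-(n : ℝ) * V x)) := by
    funext x
    rw [heval, Finset.mul_sum, Finset.sum_mul]
    exact Finset.sum_congr rfl fun i _ => by ring
  rw [e, integral_finsetSum]
  · refine Finset.sum_eq_zero fun i hi => ?_
    rw [integral_const_mul, hz i (by have := Finset.mem_range.1 hi; omega), mul_zero]
  · intro i _
    refine Integrable.const_mul (ExpBounded.integrable ?_ hV hs hn) _
    exact (ExpBounded.prod _ fun j _ => h.expBounded_left.sub_const _).mul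
      (h.expBounded_right.pow i)

lemma expBounded_biKernel (z : ℝ) : ExpBounded fun x => biKernel x z :=
  (admissiblePair_id_exp.expBounded_left.sub_const _).mul
    (admissiblePair_id_exp.expBounded_right.sub_const _)

section Biorthogonal

variable {α β V : ℝ → ℝ} {n : ℕ} {z : Fin n → ℝ}

lemma Biorthogonal.integral_erase (hz : Biorthogonal α β V z) (h : AdmissiblePair α β)
    (k : Fin n) :
    ∫ x, (α x - α (z k)) * ((∏ j ∈ Finset.univ.erase k, biKernel x (z j))
      * Real.exp (-(n : ℝ) * V x)) = 0 := by
  rw [← hz (Finset.univ.erase k) (Finset.ssubset_univ_iff.1 (Finset.erase_ssubset (by simp)))]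
  refine integral_congr_ae (ae_of_all _ fun x => ?_)
  simp only
  rw [← Finset.mul_prod_erase _ _ (Finset.mem_univ k)]
  simp only [← h.mul_eq, Finset.prod_mul_distrib]
  ring

lemma Biorthogonal.integral_erase_erase (hz : Biorthogonal α β V z) (h : AdmissiblePair α β)
    {k l : Fin n} (hkl : l ≠ k) :
    ∫ x, (α x - α (z k)) * (α x - α (z l))
      * ((∏ j ∈ (Finset.univ.erase k).erase l, biKernel x (z j))
      * Real.exp (-(n : ℝ) * V x)) = 0 := by
  rw [← hz ((Finset.univ.erase k).erase l) (Finset.ssubset_univ_iff.1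
    ((Finset.erase_subset _ _).trans_ssubset (Finset.erase_ssubset (by simp))))]
  refine integral_congr_ae (ae_of_all _ fun x => ?_)
  simp only
  rw [← Finset.mul_prod_erase _ _ (Finset.mem_univ k), ← Finset.mul_prod_erase
    (Finset.univ.erase k) _ (Finset.mem_erase.2 ⟨hkl, Finset.mem_univ l⟩)]
  simp only [← h.mul_eq, Finset.prod_mul_distrib]
  ring

end Biorthogonal

lemma continuous_prod_biKernel_mul {V : ℝ → ℝ} (hV : Continuous V) {ι : Type*} (S : Finset ι)
    (z : ι → ℝ) (N : ℝ) :
    Continuous fun t => (∏ j ∈ S, biKernel t (z j)) * Real.exp (-N * V t) :=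
  (continuous_finsetProd _ fun j _ => continuous_biKernel_left (z j)).mul (by fun_prop)

/-- A zero far away from the support of the equilibrium measure contradicts orthogonality.  The
sign `s` selects the side of the support on which the zero lies. -/
lemma Biorthogonal.false_of_far {ρ : Measure ℝ} {a b M : ℝ} (hρ : BoundedDensity ρ a b M)
    (hab : a ≤ b) {α β V : ℝ → ℝ} (h : AdmissiblePair α β) (hV : Continuous V)
    (hs : Superlinear V) {C : ℝ} (hC0 : 0 ≤ C)
    (hC : ∀ x z, biKernel x z ≤ Real.exp (2 * |x| + C + logPotential ρ z)) {c R D : ℝ}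
    (hD0 : 0 ≤ D) (hD : 4 * M * Real.exp (-D) < c)
    (hR : ∀ x, R ≤ |x| → 4 * |x| + C + ∫ t, V t ∂ρ + D ≤ V x) {n : ℕ} (hn : 1 ≤ n)
    {z : Fin n → ℝ} (hz : Biorthogonal α β V z) (k : Fin n) (s : ℝ)
    (h1 : ∀ x, 0 < s * (α x - α (z k)) → R ≤ |x| ∧ s * (α x - α (z k)) ≤ 2 * Real.exp |x|)
    (h2 : ∀ x ∈ Icc a b, c ≤ -(s * (α x - α (z k)))) : False := by
  set v := ∫ t, V t ∂ρ with hv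
  set E := Finset.univ.erase k with hE
  set w := ∑ j ∈ E, logPotential ρ (z j) with hw
  set G : ℝ → ℝ := fun x => (∏ j ∈ E, biKernel x (z j)) * Real.exp (-(n : ℝ) * V x) with hG
  have hG0 (x) : 0 ≤ G x :=
    mul_nonneg (Finset.prod_nonneg fun j _ => biKernel_nonneg _ _) (Real.exp_pos _).le
  have hGc : Continuous G := continuous_prod_biKernel_mul hV E z n
  have hM := hρ.pos
  have hn' : (1 : ℝ) ≤ n := by exact_mod_cast hn
  have hc : 0 < c := lt_of_le_of_lt (by positivity) hD
  have hcard : (E.card : ℝ) = n - 1 := by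
    rw [hE, Finset.card_erase_of_mem (Finset.mem_univ k)]
    simp [Nat.cast_sub hn]
  set K := 2 * Real.exp (w - n * v - D) with hK
  have hjensen := exp_sum_logPotential_le hρ hab hV E z n
  rw [← hw, ← hv] at hjensen
  have hΦ : Integrable fun x => (α x - α (z k)) * G x := by
    have : ExpBounded fun x => (α x - α (z k)) * ∏ j ∈ E, biKernel x (z j) :=
      (h.expBounded_left.sub_const _).mul (ExpBounded.prod _ fun j _ => expBounded_biKernel _)
    refine (this.integrable hV hs hn).congr (ae_of_all _ fun x => ?_)
    simp only [hG]
    ring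
  have hle (x : ℝ) : s * ((α x - α (z k)) * G x) ≤ K * Real.exp (-|x|) := by
    rcases le_or_gt (s * (α x - α (z k))) 0 with h0 | h0
    · rw [← mul_assoc]
      exact (mul_nonpos_of_nonpos_of_nonneg h0 (hG0 x)).trans (by positivity)
    obtain ⟨hx1, hx2⟩ := h1 x h0
    have hVx := hR x hx1
    have hGx : G x ≤ Real.exp ((n - 1) * (2 * |x| + C) + w - n * V x) := by
      have e : (n - 1) * (2 * |x| + C) + w = ∑ j ∈ E, (2 * |x| + C + logPotential ρ (z j)) := by
        rw [Finset.sum_add_distrib, Finset.sum_const, nsmul_eq_mul, hcard]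
      rw [sub_eq_add_neg, Real.exp_add, e, Real.exp_sum, ← neg_mul]
      exact mul_le_mul_of_nonneg_right (Finset.prod_le_prod (fun j _ => biKernel_nonneg _ _)
        fun j _ => hC x (z j)) (Real.exp_pos _).le
    calc s * ((α x - α (z k)) * G x) = s * (α x - α (z k)) * G x := by ring
      _ ≤ (2 * Real.exp |x|) * Real.exp ((n - 1) * (2 * |x| + C) + w - n * V x) :=
        mul_le_mul hx2 hGx (hG0 x) (by positivity)
      _ = 2 * Real.exp (|x| + ((n - 1) * (2 * |x| + C) + w - n * V x)) := by
        rw [Real.exp_add]; ring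
      _ ≤ 2 * Real.exp ((w - n * v - D) + -|x|) := by
        refine mul_le_mul_of_nonneg_left (Real.exp_le_exp.2 ?_) (by norm_num)
        have := mul_le_mul_of_nonneg_left hVx (by positivity : (0 : ℝ) ≤ n)
        have h3 : 0 ≤ (n : ℝ) * |x| := by positivity
        have h4 : 0 ≤ (n - 1) * D := mul_nonneg (by linarith) hD0
        linarith
      _ = K * Real.exp (-|x|) := by rw [Real.exp_add, hK]; ring
  have hpt (x : ℝ) : (Icc a b).indicator (fun x => c * G x) x
      ≤ K * Real.exp (-|x|) - s * ((α x - α (z k)) * G x) := by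
    by_cases hx : x ∈ Icc a b
    · rw [indicator_of_mem hx]
      have := mul_le_mul_of_nonneg_right (h2 x hx) (hG0 x)
      have : 0 ≤ K * Real.exp (-|x|) := by positivity
      linarith
    · rw [indicator_of_notMem hx]
      linarith [hle x]
  have hGi : IntegrableOn (fun x => c * G x) (Icc a b) :=
    (hGc.const_mul c).continuousOn.integrableOn_compact isCompact_Icc
  have hint := integral_mono (hGi.integrable_indicator measurableSet_Icc)
    ((integrable_exp_neg_abs.const_mul K).sub (hΦ.const_mul s)) hpt
  simp only [Pi.sub_apply] at hint
  rw [integral_indicator measurableSet_Icc, integral_const_mul,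
    integral_sub (integrable_exp_neg_abs.const_mul K) (hΦ.const_mul s), integral_const_mul,
    integral_const_mul, integral_exp_neg_abs, hz.integral_erase h k, mul_zero, sub_zero] at hint
  have h5 : c * Real.exp (w - n * v) ≤ M * (K * 2) := by
    calc c * Real.exp (w - n * v) ≤ c * (M * ∫ x in Icc a b, G x) :=
          mul_le_mul_of_nonneg_left hjensen hc.le
      _ = M * (c * ∫ x in Icc a b, G x) := by ring
      _ ≤ _ := mul_le_mul_of_nonneg_left hint hM.le
  have h6 : M * (K * 2) = 4 * M * Real.exp (-D) * Real.exp (w - n * v) := by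
    rw [hK, sub_eq_add_neg (w - n * v), Real.exp_add]; ring
  rw [h6] at h5
  exact absurd (le_of_mul_le_mul_right h5 (Real.exp_pos _)) (not_le.2 hD)

/-- All zeros of the biorthogonal polynomials lie in a fixed bounded interval. -/
lemma exists_forall_abs_le {ρ : Measure ℝ} {a b M : ℝ} (hρ : BoundedDensity ρ a b M)
    (hab : a ≤ b) {α β V : ℝ → ℝ} (h : AdmissiblePair α β) (hV : Continuous V)
    (hs : Superlinear V) :
    ∃ R, 1 ≤ R ∧ |a| ≤ R ∧ |b| ≤ R ∧ ∀ {n : ℕ}, 1 ≤ n → ∀ {z : Fin n → ℝ},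
      Biorthogonal α β V z → ∀ j, |z j| ≤ R := by
  obtain ⟨C, hC0, hC⟩ := exists_biKernel_le_exp hρ hab
  set R₀ := max |a| |b| with hR₀
  have hR₀0 : 0 ≤ R₀ := (abs_nonneg a).trans (le_max_left _ _)
  set c := min (α (R₀ + 1) - α R₀) (α (-R₀) - α (-R₀ - 1)) with hc
  have hc0 : 0 < c := lt_min (sub_pos.2 (h.strictMono (by linarith)))
    (sub_pos.2 (h.strictMono (by linarith)))
  have hM := hρ.pos
  set D := 4 * M / c with hDdef
  have hD0 : 0 ≤ D := by positivity
  have hD : 4 * M * Real.exp (-D) < c := by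
    rw [Real.exp_neg, ← div_eq_mul_inv, div_lt_iff₀ (Real.exp_pos _)]
    have : c * D = 4 * M := by rw [hDdef]; field_simp
    nlinarith [Real.add_one_le_exp D]
  obtain ⟨C', hC'⟩ := hs 5
  set R := max (R₀ + 1) (C' + C + ∫ t, V t ∂ρ + D) with hR
  have hRV (x : ℝ) (hx : R ≤ |x|) : 4 * |x| + C + ∫ t, V t ∂ρ + D ≤ V x := by
    linarith [hC' x, (le_max_right _ _).trans hx]
  have hR1 : R₀ + 1 ≤ R := le_max_left _ _
  refine ⟨R, by linarith, (le_max_left |a| |b|).trans (by linarith),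
    (le_max_right |a| |b|).trans (by linarith), ?_⟩
  intro n hn z hz k
  have hIcc (x) (hx : x ∈ Icc a b) : |x| ≤ R₀ := abs_le_max_abs_abs hx.1 hx.2
  by_contra! hlt
  have hexp {x y : ℝ} (hxy : |y| ≤ |x|) : |α x - α y| ≤ 2 * Real.exp |x| := by
    have := abs_sub (α x) (α y)
    have := h.left_le x
    have := h.left_le y
    have := Real.exp_le_exp.2 hxy
    linarith
  rcases le_or_gt 0 (z k) with hk | hk
  · rw [abs_of_nonneg hk] at hlt
    refine hz.false_of_far hρ hab h hV hs hC0 hC hD0 hD hRV hn k 1 (fun x hx => ?_) fun x hx => ?_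
    · have hzx : z k < x := h.strictMono.lt_iff_lt.1 (by linarith)
      have hx0 : 0 ≤ x := by linarith
      rw [one_mul]
      refine ⟨?_, (le_abs_self _).trans (hexp ?_)⟩
      · rw [abs_of_nonneg hx0]; linarith
      · rw [abs_of_nonneg hx0, abs_of_nonneg hk]; exact hzx.le
    · have h1 : α x ≤ α R₀ := h.strictMono.monotone ((le_abs_self x).trans (hIcc x hx))
      have h2 : α (R₀ + 1) ≤ α (z k) := h.strictMono.monotone (by linarith)
      linarith [min_le_left (α (R₀ + 1) - α R₀) (α (-R₀) - α (-R₀ - 1))]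
  · rw [abs_of_neg hk] at hlt
    refine hz.false_of_far hρ hab h hV hs hC0 hC hD0 hD hRV hn k (-1) (fun x hx => ?_)
      fun x hx => ?_
    · have hzx : x < z k := h.strictMono.lt_iff_lt.1 (by linarith)
      have hx0 : x < 0 := by linarith
      refine ⟨?_, ?_⟩
      · rw [abs_of_neg hx0]; linarith
      · have := (neg_le_abs _).trans (hexp (x := x) (y := z k) ?_)
        · linarith
        · rw [abs_of_neg hx0, abs_of_neg hk]; linarith
    · have h1 : α (-R₀) ≤ α x := h.strictMono.monotone
        (by linarith [neg_abs_le x, hIcc x hx])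
      have h2 : α (z k) ≤ α (-R₀ - 1) := h.strictMono.monotone (by linarith)
      linarith [min_le_right (α (R₀ + 1) - α R₀) (α (-R₀) - α (-R₀ - 1))]

/-- For any two zeros, the product of the kernels over the other zeros is large at some point
between them. -/
lemma Biorthogonal.exists_le_prod {ρ : Measure ℝ} {a b M : ℝ} (hρ : BoundedDensity ρ a b M)
    (hab : a ≤ b) {α β V : ℝ → ℝ} (h : AdmissiblePair α β) (hV : Continuous V)
    (hs : Superlinear V) {R : ℝ} (hR : 0 ≤ R) (ha : |a| ≤ R) (hb : |b| ≤ R) {n : ℕ} (hn : 1 ≤ n)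
    {z : Fin n → ℝ} (hz : Biorthogonal α β V z) (hzR : ∀ j, |z j| ≤ R) {k l : Fin n}
    (hkl : l ≠ k) :
    ∃ x, |x - z k| ≤ |z k - z l| ∧ |x| ≤ R ∧
      Real.exp (∑ j, logPotential ρ (z j) - n * ∫ t, V t ∂ρ)
        ≤ M * (4 * R * (2 * Real.exp R) ^ 4)
          * ((∏ j ∈ (Finset.univ.erase k).erase l, biKernel x (z j))
          * Real.exp (-(n : ℝ) * V x)) := by
  set E := (Finset.univ.erase k).erase l with hE
  set P : ℝ → ℝ := fun x => (∏ j ∈ E, biKernel x (z j)) * Real.exp (-(n : ℝ) * V x) with hP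
  set B := 2 * Real.exp R with hB
  have hB0 : 0 < B := by positivity
  have hP0 (x) : 0 ≤ P x :=
    mul_nonneg (Finset.prod_nonneg fun j _ => biKernel_nonneg _ _) (Real.exp_pos _).le
  have hPc : Continuous P := continuous_prod_biKernel_mul hV E z n
  obtain ⟨x, hx, hmax⟩ := isCompact_uIcc.exists_isMaxOn (nonempty_uIcc (a := z k) (b := z l))
    hPc.continuousOn
  have hxR : |x| ≤ R := (abs_le_max_abs_abs hx.1 hx.2).trans (by
    rcases le_total (z k) (z l) with h' | h' <;> simp [h', hzR])
  refine ⟨x, ?_, hxR, ?_⟩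
  · rw [abs_sub_comm (z k)]
    exact abs_sub_left_of_mem_uIcc hx
  have hbound {γ : ℝ → ℝ} (hγ : ∀ x, |γ x| ≤ Real.exp |x|) {t : ℝ} (ht : |t| ≤ R) (j : Fin n) :
      |γ t - γ (z j)| ≤ B := by
    have := abs_sub (γ t) (γ (z j))
    have := hγ t
    have := hγ (z j)
    have := Real.exp_le_exp.2 (hzR j)
    have := Real.exp_le_exp.2 ht
    linarith
  set q : ℝ → ℝ := fun t => (α t - α (z k)) * (α t - α (z l)) with hq
  have hqabs (t : ℝ) (ht : |t| ≤ R) : |q t| ≤ B ^ 2 := by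
    rw [hq, abs_mul, sq]
    exact mul_le_mul (hbound h.left_le ht k) (hbound h.left_le ht l) (abs_nonneg _) hB0.le
  have hqneg (t : ℝ) (ht : q t < 0) : t ∈ uIcc (z k) (z l) := by
    rw [hq] at ht
    have hm := h.strictMono
    rcases mul_neg_iff.1 ht with ⟨h1, h2⟩ | ⟨h1, h2⟩
    · exact mem_uIcc.2 (Or.inl ⟨(hm.lt_iff_lt.1 (sub_pos.1 h1)).le,
        (hm.lt_iff_lt.1 (sub_neg.1 h2)).le⟩)
    · exact mem_uIcc.2 (Or.inr ⟨(hm.lt_iff_lt.1 (sub_pos.1 h2)).le,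
        (hm.lt_iff_lt.1 (sub_neg.1 h1)).le⟩)
  have hlow (t : ℝ) : |q t * P t|
      ≤ q t * P t + (Icc (-R) R).indicator (fun _ => 2 * (B ^ 2 * P x)) t := by
    have hind : 0 ≤ (Icc (-R) R).indicator (fun _ => 2 * (B ^ 2 * P x)) t :=
      indicator_nonneg (fun _ _ => by have := hP0 x; positivity) t
    rcases le_or_gt 0 (q t) with h0 | h0
    · rw [abs_of_nonneg (mul_nonneg h0 (hP0 t))]
      linarith
    have htm := hqneg t h0
    have htR : |t| ≤ R := (abs_le_max_abs_abs htm.1 htm.2).trans (by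
      rcases le_total (z k) (z l) with h' | h' <;> simp [h', hzR])
    rw [indicator_of_mem (show t ∈ Icc (-R) R from abs_le.1 htR), abs_of_nonpos
      (mul_nonpos_of_nonpos_of_nonneg h0.le (hP0 t))]
    have h1 : P t ≤ P x := hmax htm
    have h2 : -q t ≤ B ^ 2 := (neg_le_abs _).trans (hqabs t htR)
    have h3 := mul_le_mul h2 h1 (hP0 t) (by positivity)
    linarith
  have hqi : Integrable fun t => q t * P t := by
    have : ExpBounded fun t => (α t - α (z k)) * (α t - α (z l)) * ∏ j ∈ E, biKernel t (z j) :=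
      ((h.expBounded_left.sub_const _).mul (h.expBounded_left.sub_const _)).mul
        (ExpBounded.prod _ fun j _ => expBounded_biKernel _)
    refine (this.integrable hV hs hn).congr (ae_of_all _ fun t => ?_)
    simp only [hP, hq]
    ring
  have hfull (t : ℝ) : (∏ j, biKernel t (z j)) * Real.exp (-(n : ℝ) * V t)
      = q t * P t * ((β t - β (z k)) * (β t - β (z l))) := by
    rw [← Finset.mul_prod_erase _ _ (Finset.mem_univ k), ← Finset.mul_prod_erase
      (Finset.univ.erase k) _ (Finset.mem_erase.2 ⟨hkl, Finset.mem_univ l⟩), ← h.mul_eq,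
      ← h.mul_eq]
    simp only [hq, hP]
    ring
  have hint0 : ∫ t, q t * P t = 0 := hz.integral_erase_erase h hkl
  have hii : Integrable ((Icc (-R) R).indicator fun _ : ℝ => 2 * (B ^ 2 * P x)) :=
    (integrableOn_const (by simp)).integrable_indicator measurableSet_Icc
  have hmain : ∫ t in Icc a b, (∏ j, biKernel t (z j)) * Real.exp (-(n : ℝ) * V t)
      ≤ 4 * R * B ^ 4 * P x := by
    have hpt (t : ℝ) : (Icc a b).indicator
        (fun t => (∏ j, biKernel t (z j)) * Real.exp (-(n : ℝ) * V t)) t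
        ≤ B ^ 2 * (q t * P t + (Icc (-R) R).indicator (fun _ => 2 * (B ^ 2 * P x)) t) := by
      have h0 := (abs_nonneg _).trans (hlow t)
      by_cases ht : t ∈ Icc a b
      · rw [indicator_of_mem ht, hfull]
        have htR : |t| ≤ R := (abs_le_max_abs_abs ht.1 ht.2).trans (max_le ha hb)
        have h1 : |(β t - β (z k)) * (β t - β (z l))| ≤ B ^ 2 := by
          rw [abs_mul, sq]
          exact mul_le_mul (hbound h.right_le htR k) (hbound h.right_le htR l) (abs_nonneg _) hB0.le
        refine (le_abs_self _).trans ?_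
        rw [abs_mul, mul_comm]
        exact mul_le_mul h1 (hlow t) (abs_nonneg _) (by positivity)
      · rw [indicator_of_notMem ht]
        positivity
    have hci : IntegrableOn (fun t => (∏ j, biKernel t (z j)) * Real.exp (-(n : ℝ) * V t))
        (Icc a b) := (continuous_prod_biKernel_mul hV Finset.univ z
          n).continuousOn.integrableOn_compact isCompact_Icc
    have := integral_mono (hci.integrable_indicator measurableSet_Icc)
      ((hqi.add hii).const_mul (B ^ 2)) hpt
    rw [integral_indicator measurableSet_Icc, integral_const_mul] at this
    simp only [Pi.add_apply] at this
    rw [integral_add hqi hii, hint0, zero_add, integral_indicator measurableSet_Icc,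
      setIntegral_const, Real.volume_real_Icc_of_le (by linarith), smul_eq_mul] at this
    linarith
  refine (exp_sum_logPotential_le hρ hab hV Finset.univ z n).trans ?_
  rw [mul_assoc]
  exact mul_le_mul_of_nonneg_left hmain hρ.pos.le

lemma abs_regLog_sub_regLog_le {s : ℝ} (hs : 0 < s) (u v : ℝ) :
    |regLog s u - regLog s v| ≤ s⁻¹ * |u - v| := by
  have hd (x : ℝ) : HasDerivAt (regLog s) (x / (x ^ 2 + s ^ 2)) x := by
    have h1 : HasDerivAt (fun x : ℝ => x ^ 2 + s ^ 2) (2 * x) x := by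
      simpa using (hasDerivAt_pow 2 x).add_const (s ^ 2)
    refine ((h1.log (by positivity)).const_mul (1 / 2)).congr_deriv ?_
    ring
  have hb (x : ℝ) : ‖x / (x ^ 2 + s ^ 2)‖ ≤ s⁻¹ := by
    have hp : 0 < x ^ 2 + s ^ 2 := by positivity
    rw [Real.norm_eq_abs, abs_div, abs_of_pos hp, ← one_div, div_le_div_iff₀ hp hs,
      ← sq_abs x]
    nlinarith [sq_nonneg (|x| - s), sq_nonneg (|x|), sq_nonneg s]
  have := Convex.norm_image_sub_le_of_norm_hasDerivWithin_le (s := univ)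
    (fun x _ => (hd x).hasDerivWithinAt) (fun x _ => hb x) convex_univ (mem_univ v) (mem_univ u)
  simpa [Real.norm_eq_abs] using this

lemma exists_abs_sub_le_of_contDiff {f : ℝ → ℝ} (hf : ContDiff ℝ 1 f) (R : ℝ) :
    ∃ K : ℝ, 0 ≤ K ∧ ∀ x y, |x| ≤ R → |y| ≤ R → |f x - f y| ≤ K * |x - y| := by
  obtain ⟨K, hK⟩ := (hf.locallyLipschitz.locallyLipschitzOn
    (s := Icc (-R) R)).exists_lipschitzOnWith_of_compact isCompact_Icc
  refine ⟨K, K.2, fun x y hx hy => ?_⟩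
  simpa [Real.dist_eq] using hK.dist_le_mul x (abs_le.1 hx) y (abs_le.1 hy)

/-- The regularization of `log (biKernel x z)` at scale `s`. -/
noncomputable def regKernel (s x z : ℝ) : ℝ :=
  regLog s (x - z) + regLog s (Real.exp x - Real.exp z)

lemma log_biKernel_le_regKernel (s : ℝ) {x z : ℝ} (h : x ≠ z) :
    Real.log (biKernel x z) ≤ regKernel s x z := by
  rw [log_biKernel]
  exact add_le_add (log_abs_le_regLog s (sub_ne_zero.2 h))
    (log_abs_le_regLog s (sub_ne_zero.2 fun h' => h (Real.exp_injective h')))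

lemma two_mul_log_le_regKernel {s : ℝ} (hs : 0 < s) (x z : ℝ) :
    2 * Real.log s ≤ regKernel s x z := by
  unfold regKernel
  linarith [log_le_regLog hs (x - z), log_le_regLog hs (Real.exp x - Real.exp z)]

lemma exists_regKernel_sub_le {s : ℝ} (hs : 0 < s) (R : ℝ) :
    ∃ K : ℝ, 0 ≤ K ∧ ∀ x y z, |x| ≤ R → |y| ≤ R →
      regKernel s x z ≤ regKernel s y z + K * |x - y| := by
  obtain ⟨K, hK0, hK⟩ := exists_abs_sub_le_of_contDiff (Real.contDiff_exp (n := 1)) R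
  refine ⟨s⁻¹ * 1 + s⁻¹ * K, by positivity, fun x y z hx hy => ?_⟩
  have h1 := (le_abs_self _).trans (abs_regLog_sub_regLog_le hs (x - z) (y - z))
  have h2 := (le_abs_self _).trans
    (abs_regLog_sub_regLog_le hs (Real.exp x - Real.exp z) (Real.exp y - Real.exp z))
  rw [sub_sub_sub_cancel_right] at h1 h2
  have h3 := mul_le_mul_of_nonneg_left (hK x y hx hy) (inv_nonneg.2 hs.le)
  unfold regKernel
  linarith

/-- The regularized energy of the zeros is almost as large as the value predicted by the
equilibrium problem. -/
lemma Biorthogonal.exists_energy_le {ρ : Measure ℝ} {a b M : ℝ} (hρ : BoundedDensity ρ a b M)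
    (hab : a ≤ b) {α β V : ℝ → ℝ} (h : AdmissiblePair α β) (hV : ContDiff ℝ 1 V)
    (hs : Superlinear V) {R : ℝ} (hR : 1 ≤ R) (ha : |a| ≤ R) (hb : |b| ≤ R) {s : ℝ} (hs0 : 0 < s) :
    ∃ K : ℝ, ∀ {n : ℕ}, 2 ≤ n → ∀ {z : Fin n → ℝ}, Biorthogonal α β V z → (∀ j, |z j| ≤ R) →
      n * ∑ j, logPotential ρ (z j) - n ^ 2 * ∫ t, V t ∂ρ + n * ∑ j, V (z j)
        ≤ ∑ k, ∑ j, regKernel s (z k) (z j) + n * K := by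
  obtain ⟨K₁, hK₁0, hK₁⟩ := exists_regKernel_sub_le hs0 R
  obtain ⟨K₂, hK₂0, hK₂⟩ := exists_abs_sub_le_of_contDiff hV R
  set Q := M * (4 * R * (2 * Real.exp R) ^ 4) with hQ
  have hM := hρ.pos
  have hQ0 : 0 < Q := by positivity
  set v := ∫ t, V t ∂ρ
  refine ⟨Real.log Q - 4 * Real.log s + (K₁ + K₂) * (4 * R), fun {n} hn {z} hz hzR => ?_⟩
  have hn0 : (0 : ℝ) ≤ n := by positivity
  have key (k l : Fin n) (hkl : l ≠ k) :
      ∑ j, logPotential ρ (z j) - n * v + n * V (z k) ≤ ∑ j, regKernel s (z k) (z j)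
        + (Real.log Q - 4 * Real.log s) + n * ((K₁ + K₂) * |z k - z l|) := by
    obtain ⟨x, hx, hxR, hexp⟩ := hz.exists_le_prod hρ hab h hV.continuous hs (by linarith) ha hb
      (by omega) hzR hkl
    set E := (Finset.univ.erase k).erase l with hE
    rw [← hQ] at hexp
    have hprod : 0 < ∏ j ∈ E, biKernel x (z j) := by
      refine (Finset.prod_nonneg fun j _ => biKernel_nonneg _ _).lt_of_ne' fun h0 => ?_
      rw [h0, zero_mul, mul_zero] at hexp
      exact (Real.exp_pos _).not_ge hexp
    rw [← Real.le_log_iff_exp_le (by positivity), Real.log_mul hQ0.ne' (by positivity),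
      Real.log_mul hprod.ne' (by positivity), Real.log_exp, Real.log_prod
      (fun j hj => Finset.prod_ne_zero_iff.1 hprod.ne' j hj)] at hexp
    have h1 : ∑ j ∈ E, Real.log (biKernel x (z j))
        ≤ ∑ j ∈ E, (regKernel s (z k) (z j) + K₁ * |z k - z l|) := by
      refine Finset.sum_le_sum fun j hj => ?_
      have hne : x ≠ z j := fun h' => by
        refine Finset.prod_ne_zero_iff.1 hprod.ne' j hj ?_
        rw [h', biKernel]; simp
      refine (log_biKernel_le_regKernel s hne).trans ((hK₁ x (z k) (z j) hxR (hzR k)).trans ?_)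
      gcongr
    have h2 : ∑ j, regKernel s (z k) (z j) = regKernel s (z k) (z k)
        + (regKernel s (z k) (z l) + ∑ j ∈ E, regKernel s (z k) (z j)) := by
      rw [← Finset.add_sum_erase _ _ (Finset.mem_univ k), ← Finset.add_sum_erase
        (Finset.univ.erase k) _ (Finset.mem_erase.2 ⟨hkl, Finset.mem_univ l⟩)]
    have h3 := two_mul_log_le_regKernel hs0 (z k) (z k)
    have h4 := two_mul_log_le_regKernel hs0 (z k) (z l)
    have h5 : (E.card : ℝ) * (K₁ * |z k - z l|) ≤ n * (K₁ * |z k - z l|) := by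
      refine mul_le_mul_of_nonneg_right ?_ (by positivity)
      exact_mod_cast (Finset.card_le_univ E).trans_eq (by simp)
    have h6 : n * (V (z k) - V x) ≤ n * (K₂ * |z k - z l|) := by
      refine mul_le_mul_of_nonneg_left ?_ hn0
      refine (le_abs_self _).trans ((hK₂ (z k) x (hzR k) hxR).trans ?_)
      rw [abs_sub_comm]
      gcongr
    rw [Finset.sum_add_distrib, Finset.sum_const, nsmul_eq_mul] at h1
    linarith
  obtain ⟨l, hl, hsum⟩ := exists_partner hn z hzR
  have htot := Finset.sum_le_sum fun k (_ : k ∈ Finset.univ) => key k (l k) (hl k)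
  simp only [Finset.sum_add_distrib, Finset.sum_const, Finset.card_univ, Fintype.card_fin,
    nsmul_eq_mul, ← Finset.mul_sum] at htot
  have h7 := mul_le_mul_of_nonneg_left hsum (mul_nonneg hn0 (add_nonneg hK₁0 hK₂0))
  nlinarith

/-- The normalized counting measure of a finite family of reals. -/
noncomputable def empiricalMeasure {n : ℕ} (z : Fin n → ℝ) : Measure ℝ :=
  (n : ENNReal)⁻¹ • ∑ j, Measure.dirac (z j)

lemma isProbabilityMeasure_empiricalMeasure {n : ℕ} (hn : n ≠ 0) (z : Fin n → ℝ) :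
    IsProbabilityMeasure (empiricalMeasure z) := by
  refine ⟨?_⟩
  simp only [empiricalMeasure, Measure.smul_apply, Measure.finsetSum_apply, measure_univ,
    Finset.sum_const, Finset.card_univ, Fintype.card_fin, nsmul_eq_mul, mul_one, smul_eq_mul]
  exact ENNReal.inv_mul_cancel (by exact_mod_cast hn) (ENNReal.natCast_ne_top n)

lemma integral_empiricalMeasure {n : ℕ} (z : Fin n → ℝ) (f : ℝ → ℝ) :
    ∫ x, f x ∂(empiricalMeasure z) = 1 / (n : ℝ) * ∑ j, f (z j) := by
  rw [empiricalMeasure, integral_smul_measure, integral_finsetSum_measure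
    fun j _ => integrable_dirac (by simp)]
  simp

lemma ae_empiricalMeasure {n : ℕ} {z : Fin n → ℝ} {p : ℝ → Prop} (h : ∀ j, p (z j)) :
    ∀ᵐ x ∂(empiricalMeasure z), p x := by
  refine Measure.ae_smul_measure ?_ _
  rw [← Measure.sum_fintype, Measure.ae_sum_iff]
  intro j
  rw [ae_dirac_eq]
  exact h j

lemma integrable_prod_of_ae_abs_le {μ ν : Measure ℝ} [IsProbabilityMeasure μ]
    [IsProbabilityMeasure ν] {R : ℝ} (hμ : ∀ᵐ x ∂μ, |x| ≤ R) (hν : ∀ᵐ x ∂ν, |x| ≤ R)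
    {F : ℝ × ℝ → ℝ} (hF : Continuous F) : Integrable F (μ.prod ν) := by
  obtain ⟨C, hC⟩ := ((isCompact_Icc (a := -R) (b := R)).prod
    (isCompact_Icc (a := -R) (b := R))).exists_bound_of_continuousOn hF.continuousOn
  refine Integrable.of_bound hF.aestronglyMeasurable C ?_
  have h1 := Measure.quasiMeasurePreserving_fst (μ := μ) (ν := ν) |>.ae hμ
  have h2 := Measure.quasiMeasurePreserving_snd (μ := μ) (ν := ν) |>.ae hν
  filter_upwards [h1, h2] with p hp1 hp2
  exact hC _ ⟨abs_le.1 hp1, abs_le.1 hp2⟩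

lemma continuous_regKernel {s : ℝ} (hs : 0 < s) :
    Continuous fun p : ℝ × ℝ => regKernel s p.1 p.2 := by
  have := continuous_regLog hs
  unfold regKernel
  fun_prop

lemma regKernel_comm (s x z : ℝ) : regKernel s x z = regKernel s z x := by
  unfold regKernel regLog
  rw [← neg_sub z x, ← neg_sub (Real.exp z), neg_sq, neg_sq]

lemma diffEnergy_add_diffEnergy_map_exp {μ ν : Measure ℝ} [IsProbabilityMeasure μ]
    [IsProbabilityMeasure ν] {R : ℝ} (hμ : ∀ᵐ x ∂μ, |x| ≤ R) (hν : ∀ᵐ x ∂ν, |x| ≤ R) {s : ℝ}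
    (hs : 0 < s) :
    diffEnergy μ ν (regLog s) + diffEnergy (μ.map Real.exp) (ν.map Real.exp) (regLog s)
      = ∫ p, regKernel s p.1 p.2 ∂(μ.prod μ) - 2 * ∫ p, regKernel s p.1 p.2 ∂(μ.prod ν)
        + ∫ p, regKernel s p.1 p.2 ∂(ν.prod ν) := by
  have hc := continuous_regLog hs
  have key {μ ν : Measure ℝ} [IsProbabilityMeasure μ] [IsProbabilityMeasure ν]
      (hμ : ∀ᵐ x ∂μ, |x| ≤ R) (hν : ∀ᵐ x ∂ν, |x| ≤ R) :
      ∫ p, regKernel s p.1 p.2 ∂(μ.prod ν) = ∫ p, regLog s (p.1 - p.2) ∂(μ.prod ν)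
        + ∫ p, regLog s (p.1 - p.2) ∂((μ.map Real.exp).prod (ν.map Real.exp)) := by
    rw [Measure.map_prod_map _ _ Real.measurable_exp Real.measurable_exp, integral_map
      (by fun_prop) (by fun_prop)]
    exact integral_add (integrable_prod_of_ae_abs_le hμ hν (by fun_prop))
      (integrable_prod_of_ae_abs_le hμ hν (F := fun p => regLog s (Real.exp p.1 - Real.exp p.2))
        (by fun_prop))
  rw [key hμ hμ, key hμ hν, key hν hν, diffEnergy, diffEnergy]
  ring

/-- The regularized potential of `ρ`. -/
noncomputable def regPotential (ρ : Measure ℝ) (s z : ℝ) : ℝ := ∫ t, regKernel s z t ∂ρ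

namespace BoundedDensity

variable {ρ : Measure ℝ} {a b M : ℝ}

lemma integrable_regKernel (h : BoundedDensity ρ a b M) {s : ℝ} (hs : 0 < s) (z : ℝ) :
    Integrable (fun t => regKernel s z t) ρ :=
  h.integrable_of_continuous ((continuous_regKernel hs).comp (by fun_prop : Continuous
    fun t : ℝ => (z, t)))

lemma logPotential_le_regPotential (h : BoundedDensity ρ a b M) (hab : a ≤ b) {s : ℝ}
    (hs : 0 < s) (z : ℝ) : logPotential ρ z ≤ regPotential ρ s z := by
  refine integral_mono_ae (h.integrable_log_biKernel hab z) (h.integrable_regKernel hs z) ?_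
  filter_upwards [h.ae_ne z] with t ht
  rw [regKernel_comm]
  exact log_biKernel_le_regKernel s ht

lemma exists_regPotential_le (h : BoundedDensity ρ a b M) (hab : a ≤ b) {R : ℝ} (ha : |a| ≤ R)
    (hb : |b| ≤ R) :
    ∃ c, 0 ≤ c ∧ ∀ s, 0 < s → ∀ z, |z| ≤ R → regPotential ρ s z ≤ logPotential ρ z + c * s := by
  set I := ∫ u, logDefect u
  have hI : 0 ≤ I := integral_nonneg logDefect_nonneg
  have hM := h.pos
  refine ⟨M * I * (1 + Real.exp R), by positivity, fun s hs z hz => ?_⟩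
  obtain ⟨i1, h1⟩ := h.integral_logDefect_le hs z
  obtain ⟨i2, h2⟩ := h.integral_logDefect_le (mul_pos hs (Real.exp_pos R)) z
  have hle : regPotential ρ s z ≤ ∫ t, (Real.log (biKernel t z) + (logDefect ((t - z) / s)
      + logDefect ((t - z) / (s * Real.exp R)))) ∂ρ := by
    refine integral_mono_ae (h.integrable_regKernel hs z)
      ((h.integrable_log_biKernel hab z).add (i1.add i2)) ?_
    filter_upwards [h.ae_ne z, h.ae_abs_le ha hb] with t ht htR
    have hne := sub_ne_zero.2 ht
    rw [regKernel_comm, regKernel, log_biKernel]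
    have h3 := regLog_sub_log_abs_le hs hne le_rfl
    have h4 : |(t - z) / Real.exp R| ≤ |Real.exp t - Real.exp z| := by
      have key {x y : ℝ} (hy : |y| ≤ R) (hxy : y ≤ x) :
          |(x - y) / Real.exp R| ≤ |Real.exp x - Real.exp y| := by
        rw [abs_of_nonneg (div_nonneg (by linarith) (Real.exp_pos R).le),
          abs_of_nonneg (sub_nonneg.2 (Real.exp_le_exp.2 hxy)), div_eq_mul_inv, ← Real.exp_neg]
        have e : Real.exp x - Real.exp y = (Real.exp (x - y) - 1) * Real.exp y := by
          rw [sub_mul, ← Real.exp_add]; ring_nf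
        rw [e]
        exact mul_le_mul (by linarith [Real.add_one_le_exp (x - y)])
          (Real.exp_le_exp.2 (abs_le.1 hy).1) (Real.exp_pos _).le
          (by linarith [Real.add_one_le_exp (x - y)])
      rcases le_total z t with h' | h'
      · exact key hz h'
      · rw [abs_sub_comm (Real.exp t), ← neg_sub z t, neg_div, abs_neg]
        exact key htR h'
    have h5 := regLog_sub_log_abs_le hs (div_ne_zero hne (Real.exp_pos R).ne') h4
    rw [div_div, mul_comm (Real.exp R)] at h5
    linarith
  have i12 : Integrable (fun t => logDefect ((t - z) / s)
      + logDefect ((t - z) / (s * Real.exp R))) ρ := i1.add i2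
  rw [integral_add (h.integrable_log_biKernel hab z) i12, integral_add i1 i2] at hle
  unfold logPotential
  linarith

end BoundedDensity

/-- The regularized energy distance of the empirical measure of the zeros to `ρ`. -/
lemma diffEnergy_empiricalMeasure {ρ : Measure ℝ} {a b M : ℝ} (hρ : BoundedDensity ρ a b M)
    {R : ℝ} (ha : |a| ≤ R) (hb : |b| ≤ R) {s : ℝ} (hs : 0 < s) {n : ℕ} (hn : n ≠ 0)
    {z : Fin n → ℝ} (hz : ∀ j, |z j| ≤ R) :
    diffEnergy (empiricalMeasure z) ρ (regLog s)
      + diffEnergy ((empiricalMeasure z).map Real.exp) (ρ.map Real.exp) (regLog s)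
      = 1 / (n : ℝ) * ∑ k, (1 / (n : ℝ) * ∑ j, regKernel s (z k) (z j))
        - 2 * (1 / (n : ℝ) * ∑ k, regPotential ρ s (z k)) + ∫ t, regPotential ρ s t ∂ρ := by
  have := hρ.prob
  have := isProbabilityMeasure_empiricalMeasure hn z
  have hμ := ae_empiricalMeasure (p := fun x => |x| ≤ R) hz
  have hν := hρ.ae_abs_le ha hb
  have hc := continuous_regKernel hs
  rw [diffEnergy_add_diffEnergy_map_exp hμ hν hs,
    integral_prod _ (integrable_prod_of_ae_abs_le hμ hμ hc),
    integral_prod _ (integrable_prod_of_ae_abs_le hμ hν hc),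
    integral_prod _ (integrable_prod_of_ae_abs_le hν hν hc)]
  simp only [integral_empiricalMeasure, regPotential]

/-- Convergence of the empirical measures of biorthogonal zeros to the equilibrium measure. -/
lemma tendsto_empiricalMeasure {ρ : Measure ℝ} {a b M : ℝ} (hρ : BoundedDensity ρ a b M)
    (hab : a ≤ b) {α β V : ℝ → ℝ} (h : AdmissiblePair α β) (hV : ContDiff ℝ 1 V)
    (hs : Superlinear V) {ℓ : ℝ} (heq : ∀ x ∈ Icc a b, V x = logPotential ρ x - ℓ)
    (hle : ∀ x, logPotential ρ x - ℓ ≤ V x) {z : ∀ n : ℕ, Fin n → ℝ}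
    (hz : ∀ n, 1 ≤ n → Biorthogonal α β V (z n)) {f : ℝ → ℝ} (hf : Continuous f) {C : ℝ}
    (hfC : ∀ x, |f x| ≤ C) :
    Tendsto (fun n : ℕ => 1 / (n : ℝ) * ∑ j, f (z n j)) atTop (nhds (∫ x, f x ∂ρ)) := by
  obtain ⟨R, hR1, ha, hb, hR⟩ := exists_forall_abs_le hρ hab h hV.continuous hs
  obtain ⟨c, hc0, hc⟩ := hρ.exists_regPotential_le hab ha hb
  have := hρ.prob
  have hν := hρ.ae_abs_le ha hb
  rw [← tendsto_add_atTop_iff_nat 1]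
  have hprob : ∀ m, IsProbabilityMeasure (empiricalMeasure (z (m + 1))) := fun m =>
    isProbabilityMeasure_empiricalMeasure m.succ_ne_zero _
  have hzR (m : ℕ) : ∀ j, |z (m + 1) j| ≤ R := hR m.succ_pos (hz _ m.succ_pos)
  have hμ (m : ℕ) : ∀ᵐ x ∂(empiricalMeasure (z (m + 1))), |x| ≤ R := ae_empiricalMeasure (hzR m)
  simp only [← integral_empiricalMeasure]
  refine tendsto_integral_of_charFun (N := 0) (fun m _ => hμ m) hν ?_ hf hfC
  have hbound (s : ℝ) (hs0 : 0 < s) (hs1 : s ≤ 1) : ∃ K : ℝ, ∀ m : ℕ, 1 ≤ m →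
      ∫ u in Ioi (0 : ℝ), Real.exp (-2 * u) * ‖charFun (empiricalMeasure (z (m + 1))) u
        - charFun ρ u‖ ^ 2 ≤ 2 * (c * s) + K / (m + 1 : ℕ) := by
    obtain ⟨K, hK⟩ := Biorthogonal.exists_energy_le hρ hab h hV hs hR1 ha hb hs0
    refine ⟨K, fun m hm => ?_⟩
    set n := m + 1 with hn
    have hn0 : (0 : ℝ) < n := by positivity
    have henergy := hK (n := n) (by omega) (hz n (by omega)) (hzR m)
    refine (integral_normSq_charFun_le (hμ m) hν hs0 hs1).trans ?_
    have hexp {μ : Measure ℝ} (hμ : ∀ᵐ x ∂μ, |x| ≤ R) :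
        ∀ᵐ x ∂(μ.map Real.exp), |x| ≤ Real.exp R := by
      rw [ae_map_iff (by fun_prop) (measurableSet_le (by fun_prop) (by fun_prop))]
      filter_upwards [hμ] with x hx
      rw [Real.abs_exp]
      exact Real.exp_le_exp.2 ((le_abs_self x).trans hx)
    have := Measure.isProbabilityMeasure_map (μ := empiricalMeasure (z n))
      Real.measurable_exp.aemeasurable
    have := Measure.isProbabilityMeasure_map (μ := ρ) Real.measurable_exp.aemeasurable
    have hneg := diffEnergy_regLog_nonpos (hexp (hμ m)) (hexp hν) hs0
    have hsum := diffEnergy_empiricalMeasure (n := n) hρ ha hb hs0 m.succ_ne_zero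
      (z := z n) (hzR m)
    change -diffEnergy (empiricalMeasure (z n)) ρ (regLog s) ≤ 2 * (c * s) + K / (n : ℝ)
    change diffEnergy ((empiricalMeasure (z n)).map Real.exp) (ρ.map Real.exp) (regLog s) ≤ 0
      at hneg
    have hv : ∫ t, V t ∂ρ ≤ ∫ t, regPotential ρ s t ∂ρ - ℓ := by
      have hreg : Integrable (fun t => regPotential ρ s t) ρ :=
        (integrable_prod_of_ae_abs_le hν hν (continuous_regKernel hs0)).integral_prod_left
      have e : ∫ t, regPotential ρ s t ∂ρ - ℓ = ∫ t, (regPotential ρ s t - ℓ) ∂ρ := by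
        rw [integral_sub hreg (integrable_const ℓ)]; simp
      rw [e]
      refine integral_mono_ae (hρ.integrable_of_continuous hV.continuous)
        (hreg.sub (integrable_const ℓ)) ?_
      filter_upwards [hρ.ae_mem] with t ht
      rw [heq t ht]
      exact sub_le_sub_right (hρ.logPotential_le_regPotential hab hs0 t) ℓ
    have h1 : ∑ k, logPotential ρ (z n k) - n * ℓ ≤ ∑ k, V (z n k) := by
      have := Finset.sum_le_sum fun k (_ : k ∈ Finset.univ) => hle (z n k)
      simpa [Finset.sum_sub_distrib] using this
    have h2 : ∑ k, regPotential ρ s (z n k) ≤ ∑ k, logPotential ρ (z n k) + n * (c * s) := by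
      have := Finset.sum_le_sum fun k (_ : k ∈ Finset.univ) => hc s hs0 (z n k) (hzR m k)
      simpa [Finset.sum_add_distrib] using this
    rw [← Finset.mul_sum] at hsum
    set E := ∑ k, ∑ j, regKernel s (z n k) (z n j)
    set P := ∑ k, regPotential ρ s (z n k)
    set L := ∑ k, logPotential ρ (z n k)
    set Q := ∫ t, regPotential ρ s t ∂ρ
    have h3 : 2 * n * P - n ^ 2 * Q - E ≤ n ^ 2 * (2 * (c * s)) + n * K := by
      have := mul_le_mul_of_nonneg_left h1 hn0.le
      have := mul_le_mul_of_nonneg_left h2 hn0.le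
      have := mul_le_mul_of_nonneg_left hv (sq_nonneg (n : ℝ))
      nlinarith
    have h4 : 2 * (1 / (n : ℝ) * P) - Q - 1 / n * (1 / n * E) ≤ 2 * (c * s) + K / n := by
      have e1 : 2 * (1 / (n : ℝ) * P) - Q - 1 / n * (1 / n * E)
          = (2 * n * P - n ^ 2 * Q - E) / n ^ 2 := by field_simp
      have e2 : 2 * (c * s) + K / n = (n ^ 2 * (2 * (c * s)) + n * K) / n ^ 2 := by field_simp
      rw [e1, e2]
      exact div_le_div_of_nonneg_right h3 (sq_nonneg _)
    linarith
  rw [Metric.tendsto_atTop]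
  intro η hη
  set s := min 1 (η / (4 * c + 4)) with hsdef
  have hs0 : 0 < s := lt_min one_pos (by positivity)
  have hcs : 2 * (c * s) < η / 2 := by
    have h1 : s ≤ η / (4 * c + 4) := min_le_right _ _
    rw [le_div_iff₀ (by positivity)] at h1
    linarith
  obtain ⟨K, hK⟩ := hbound s hs0 (min_le_left _ _)
  have hlim : Tendsto (fun m : ℕ => K / (m + 1 : ℕ)) atTop (nhds 0) :=
    (tendsto_const_div_atTop_nhds_zero_nat K).comp (tendsto_add_atTop_nat 1)
  obtain ⟨N, hN⟩ := eventually_atTop.1 (hlim.eventually_lt_const (half_pos hη))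
  refine ⟨max N 1, fun m hm => ?_⟩
  rw [Real.dist_eq, sub_zero, abs_of_nonneg (integral_nonneg fun u => by positivity)]
  linarith [hK m ((le_max_right _ _).trans hm), hN m ((le_max_left _ _).trans hm)]

namespace OneCutData

variable {V : ℝ → ℝ} {a b : ℝ} {ψ : ℝ → ℝ} {ℓ : ℝ}

/-- The equilibrium measure `ψ(x) dx` on `[a, b]`. -/
noncomputable def measure (_ : OneCutData V a b ψ ℓ) : Measure ℝ :=
  (volume.restrict (Icc a b)).withDensity fun x => ENNReal.ofReal (ψ x)

lemma integral_measure (h : OneCutData V a b ψ ℓ) (f : ℝ → ℝ) :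
    ∫ x, f x ∂h.measure = ∫ x in a..b, f x * ψ x := by
  have hm : AEMeasurable (fun x => ENNReal.ofReal (ψ x)) (volume.restrict (Icc a b)) :=
    (h.cont.aemeasurable measurableSet_Icc).ennreal_ofReal
  rw [measure, integral_withDensity_eq_integral_toReal_smul₀ hm (by simp),
    intervalIntegral.integral_of_le h.lt.le, ← integral_Icc_eq_integral_Ioc]
  refine setIntegral_congr_fun measurableSet_Icc fun x hx => ?_
  simp only [smul_eq_mul]
  rw [ENNReal.toReal_ofReal (h.nonneg x hx), mul_comm]

lemma exists_boundedDensity (h : OneCutData V a b ψ ℓ) :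
    ∃ M, BoundedDensity h.measure a b M := by
  obtain ⟨M, hM⟩ := isCompact_Icc.exists_bound_of_continuousOn h.cont
  refine ⟨|M| + 1, ⟨?_⟩, by positivity, ?_⟩
  · rw [measure, withDensity_apply _ MeasurableSet.univ, Measure.restrict_univ,
      ← ofReal_integral_eq_lintegral_ofReal (h.cont.integrableOn_compact isCompact_Icc)
        ((ae_restrict_iff' measurableSet_Icc).2 (ae_of_all _ h.nonneg)),
      integral_Icc_eq_integral_Ioc, ← intervalIntegral.integral_of_le h.lt.le, h.total_mass]
    simp
  · rw [measure, ← withDensity_const]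
    refine withDensity_mono ((ae_restrict_iff' measurableSet_Icc).2 (ae_of_all _ fun x hx => ?_))
    refine ENNReal.ofReal_le_ofReal ?_
    have := hM x hx
    rw [Real.norm_eq_abs] at this
    linarith [le_abs_self (ψ x), le_abs_self M]

lemma logPotential_measure (h : OneCutData V a b ψ ℓ) (x : ℝ) :
    logPotential h.measure x = -((∫ t in a..b, -Real.log |t - x| * ψ t)
      + ∫ t in a..b, -Real.log |Real.exp t - Real.exp x| * ψ t) := by
  obtain ⟨M, hM⟩ := h.exists_boundedDensity
  have hint {g : ℝ → ℝ} (hg : ∀ t, AnalyticAt ℝ g t) :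
      Integrable (fun t => Real.log |g t|) h.measure := by
    have hmer : MeromorphicOn g (uIcc a b) := fun t _ => (hg t).meromorphicAt
    exact hM.integrable_of_intervalIntegrable h.lt.le hmer.intervalIntegrable_log_norm
  rw [← h.integral_measure, ← h.integral_measure, integral_neg, integral_neg, logPotential,
    ← neg_add, neg_neg, ← integral_add (hint fun t => by fun_prop) (hint fun t => by fun_prop)]
  simp only [log_biKernel]

lemma eq_logPotential_sub (h : OneCutData V a b ψ ℓ) {x : ℝ} (hx : x ∈ Icc a b) :
    V x = logPotential h.measure x - ℓ := by
  rw [h.logPotential_measure]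
  linarith [h.var_eq x hx]

lemma logPotential_sub_le (h : OneCutData V a b ψ ℓ) (x : ℝ) :
    logPotential h.measure x - ℓ ≤ V x := by
  by_cases hx : x ∈ Icc a b
  · exact (h.eq_logPotential_sub hx).ge
  · rw [h.logPotential_measure]
    linarith [h.var_ineq x hx]

end OneCutData

/-- **Corollary: convergence of zero counting measures.** For a one-cut regular
external field `V`, the normalized zero counting measures of the type II multiple orthogonal
polynomials `p_n(x) = ∏ (x − z_j⁽ⁿ⁾)` and of the type I polynomials
`q_n(eˣ) = ∏ (eˣ − e^{ẑ_j⁽ⁿ⁾})` converge weakly to the equilibrium measure `ψ(x)dx` on `[a,b]`. -/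
theorem zero_counting_measures_converge
    (V : ℝ → ℝ) (hanalytic : ∀ x : ℝ, AnalyticAt ℝ V x)
    (hgrowth : Tendsto (fun x => V x / (|x| + 1)) atTop atTop ∧
      Tendsto (fun x => V x / (|x| + 1)) atBot atTop)
    (a b : ℝ) (ψ : ℝ → ℝ) (ℓ : ℝ) (hdata : OneCutData V a b ψ ℓ)
    (z zhat : ℕ → ℕ → ℝ)
    (horthoII : ∀ n : ℕ, 1 ≤ n → ∀ k < n,
      ∫ x : ℝ, (∏ j ∈ Finset.range n, (x - z n j)) * Real.exp ((k : ℝ) * x)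
        * Real.exp (-(n : ℝ) * V x) = 0)
    (horthoI : ∀ n : ℕ, 1 ≤ n → ∀ k < n,
      ∫ x : ℝ, x ^ k * (∏ j ∈ Finset.range n, (Real.exp x - Real.exp (zhat n j)))
        * Real.exp (-(n : ℝ) * V x) = 0) :
    ∀ f : ℝ → ℝ, Continuous f → (∃ M : ℝ, ∀ x : ℝ, |f x| ≤ M) →
      Tendsto (fun n : ℕ => (1 / (n : ℝ)) * ∑ j ∈ Finset.range n, f (z n j)) atTop
        (nhds (∫ x in a..b, f x * ψ x)) ∧
      Tendsto (fun n : ℕ => (1 / (n : ℝ)) * ∑ j ∈ Finset.range n, f (zhat n j)) atTop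
        (nhds (∫ x in a..b, f x * ψ x)) := by
  have hV : ContDiff ℝ 1 V := AnalyticOnNhd.contDiff fun x _ => hanalytic x
  have hs := superlinear_of_tendsto hV.continuous hgrowth.1 hgrowth.2
  obtain ⟨M, hM⟩ := hdata.exists_boundedDensity
  rintro f hf ⟨C, hC⟩
  rw [← hdata.integral_measure]
  have main {α β : ℝ → ℝ} (h : AdmissiblePair α β) (y : ℕ → ℕ → ℝ)
      (hy : ∀ n : ℕ, 1 ≤ n → ∀ k < n, ∫ x : ℝ, (∏ j ∈ Finset.range n, (α x - α (y n j)))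
        * β x ^ k * Real.exp (-(n : ℝ) * V x) = 0) :
      Tendsto (fun n : ℕ => (1 / (n : ℝ)) * ∑ j ∈ Finset.range n, f (y n j)) atTop
        (nhds (∫ x, f x ∂hdata.measure)) := by
    simp only [Finset.sum_range]
    refine tendsto_empiricalMeasure hM hdata.lt.le h hV hs (fun x hx => hdata.eq_logPotential_sub hx)
      hdata.logPotential_sub_le (z := fun n j => y n j) (fun n hn => ?_) hf hC
    refine h.biorthogonal hV.continuous hs hn fun k hk => ?_
    simpa only [Finset.prod_range] using hy n hn k hk
  refine ⟨main admissiblePair_id_exp z fun n hn k hk => ?_,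
    main admissiblePair_exp_id zhat fun n hn k hk => ?_⟩
  · simpa only [Real.exp_nat_mul] using horthoII n hn k hk
  · simpa only [mul_comm] using horthoI n hn k hk
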